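/- arXiv:math/0504547 — 3 statements merged into one kernel-verified Lean document; each statement's English description precedes it below -/
import Mathlib

section
/- Let (Q,I) be a gentle quiver with set of vertices Q_0, let K be a field and A = KQ/I the corresponding gentle algebra. For each k ≥ 1 let c_k denote the number of minimal oriented k-cycles in Q with full zero relations. Then the q-Cartan matrix C_A(q) is unimodularly equivalent over ℤ[q] to a diagonal matrix whose diagonal entries are 1 − (−q)^k with multiplicity c_k for each k ≥ 1, and all further diagonal entries equal to 1. -/
/-! Combinatorial model of a finite quiver with (quadratic monomial) relations.

For a monomial algebra `A = KQ/I` (with `I` generated by paths of length 2),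
a basis of `e_i A e_j` is given by the paths from `i` to `j` avoiding the
relations, so all Cartan-type invariants are encoded combinatorially. -/

/-- A finite quiver together with a set of quadratic (length two) monomial
relations: `rel a b` means that the length-two path `ab` belongs to the
relation ideal `I`. -/
structure QuivRel where
  /-- vertices -/
  V : Type
  /-- arrows -/
  A : Type
  [instVFin : Fintype V]
  [instVDec : DecidableEq V]
  [instAFin : Fintype A]
  [instADec : DecidableEq A]
  /-- start vertex of an arrow -/
  src : A → V
  /-- end vertex of an arrow -/
  tgt : A → V
  /-- the set of length-two zero relations -/
  rel : A → A → Prop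
  rel_comp : ∀ a b, rel a b → tgt a = src b

attribute [instance] QuivRel.instVFin QuivRel.instVDec QuivRel.instAFin QuivRel.instADec

namespace QuivRel

variable (G : QuivRel)

/-- Condition (i) and (ii): `(Q,I)` is special biserial (the relation ideal `I`
being generated by the paths of length two recorded in `rel`). -/
def SpecialBiserial : Prop :=
  (∀ v : G.V, Nat.card {a : G.A // G.src a = v} ≤ 2) ∧
  (∀ v : G.V, Nat.card {a : G.A // G.tgt a = v} ≤ 2) ∧
  (∀ a b c : G.A, G.tgt a = G.src b → ¬ G.rel a b → G.tgt a = G.src c → ¬ G.rel a c → b = c) ∧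
  (∀ a b c : G.A, G.tgt b = G.src a → ¬ G.rel b a → G.tgt c = G.src a → ¬ G.rel c a → b = c)

/-- `(Q,I)` is a gentle quiver: special biserial, `I` generated by paths of
length two (built into the data), and conditions (iv). -/
def Gentle : Prop :=
  G.SpecialBiserial ∧
  (∀ a b c : G.A, G.rel a b → G.rel a c → b = c) ∧
  (∀ a b c : G.A, G.rel b a → G.rel c a → b = c)

/-- A (composable) path all of whose length-two subpaths avoid the relations;
these are exactly the paths which are nonzero in the monomial algebra `KQ/I`. -/
def IsNonzeroPath (p : List G.A) : Prop :=
  p.Chain' (fun a b => G.tgt a = G.src b ∧ ¬ G.rel a b)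

/-- Nonzero paths from `i` to `j`; the empty list is the trivial path `e_i`
(so we require `i = j` for it). -/
def IsNonzeroPathFrom (i j : G.V) (p : List G.A) : Prop :=
  G.IsNonzeroPath p ∧ (∀ a ∈ p.head?, G.src a = i) ∧
    (∀ a ∈ p.getLast?, G.tgt a = j) ∧ (p = [] → i = j)

/-- Finite-dimensionality of `KQ/I`: nonzero paths have bounded length. -/
def FinDim : Prop := ∃ N, ∀ p : List G.A, G.IsNonzeroPath p → p.length ≤ N

/-- The `q`-Cartan matrix of `A = KQ/I`: the `(i,j)`-entry is the Poincaré
polynomial `∑_n dim_K (e_i A e_j)_n qⁿ`, i.e. each nonzero path from `i` to `j`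
contributes `q^(its length)`. -/
noncomputable def qCartan : Matrix G.V G.V (Polynomial ℤ) := fun i j =>
  ∑ᶠ n : ℕ,
    (Nat.card {p : List G.A // p.length = n ∧ G.IsNonzeroPathFrom i j p} : Polynomial ℤ) *
      Polynomial.X ^ n

/-- The ordinary Cartan matrix of `A = KQ/I`: the `(i,j)`-entry is
`dim_K e_i A e_j`, the number of nonzero paths from `i` to `j`. -/
noncomputable def cartan : Matrix G.V G.V ℤ := fun i j =>
  (Nat.card {p : List G.A // G.IsNonzeroPathFrom i j p} : ℤ)

/-- An oriented cycle with full zero relations, recorded as the (nonempty) list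
of its arrows: any two cyclically consecutive arrows form a relation (this in
particular forces consecutive arrows to be composable, and the start and end
points to agree). -/
def IsZeroCycle (p : List G.A) : Prop :=
  p ≠ [] ∧ ∀ i : Fin p.length,
    G.rel (p.get i) (p.get ⟨(i.1 + 1) % p.length,
      Nat.mod_lt _ (Nat.lt_of_le_of_lt (Nat.zero_le _) i.2)⟩)

/-- A minimal oriented cycle with full zero relations: its arrows are pairwise
distinct. -/
def IsMinZeroCycle (p : List G.A) : Prop := G.IsZeroCycle p ∧ p.Nodup

/-- Lists satisfying a property, up to cyclic rotation. Oriented cycles are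
sequences of arrows up to cyclic rotation. -/
def cycleSetoid (P : List G.A → Prop) : Setoid {p : List G.A // P p} :=
  Setoid.comap Subtype.val (List.IsRotated.setoid G.A)

/-- `c_k`, the number of minimal oriented `k`-cycles in `Q` with full zero
relations (cycles being counted up to cyclic rotation). -/
noncomputable def numCycles (k : ℕ) : ℕ :=
  Nat.card (Quotient (G.cycleSetoid (fun p => G.IsMinZeroCycle p ∧ p.length = k)))

/-- The total number of minimal oriented cycles in `Q` with full zero relations. -/
noncomputable def totalCycles : ℕ :=
  Nat.card (Quotient (G.cycleSetoid (fun p => G.IsMinZeroCycle p)))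

/-- `ec(Q,I)`, the number of minimal oriented cycles with full zero relations
of even length. -/
noncomputable def ec : ℕ :=
  Nat.card (Quotient (G.cycleSetoid (fun p => G.IsMinZeroCycle p ∧ Even p.length)))

/-- `oc(Q,I)`, the number of minimal oriented cycles with full zero relations
of odd length. -/
noncomputable def oc : ℕ :=
  Nat.card (Quotient (G.cycleSetoid (fun p => G.IsMinZeroCycle p ∧ Odd p.length)))

end QuivRel

/-- Two square matrices over a commutative ring are unimodularly equivalent if
they differ by multiplication by matrices of determinant `1` on either side. -/
def UnimodEquiv {n : Type} [Fintype n] [DecidableEq n] {R : Type} [CommRing R]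
    (C D : Matrix n n R) : Prop :=
  ∃ P Q : Matrix n n R, P.det = 1 ∧ Q.det = 1 ∧ D = P * C * Q
theorem Matrix.det_eq_one_of_rank {n α R : Type*} [Fintype n] [DecidableEq n] [LinearOrder α]
    [CommRing R] {M : Matrix n n R} (b : n → α) (hd : ∀ i, M i i = 1)
    (hM : ∀ i j, i ≠ j → M i j ≠ 0 → b i < b j) : M.det = 1 := by
  have ht : M.BlockTriangular b := by
    intro i j hij
    by_contra h
    exact lt_asymm hij (hM i j (fun e => by simp [e] at hij) h)
  rw [ht.det]
  refine Finset.prod_eq_one fun a _ => ?_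
  have : M.toSquareBlock b a = 1 := by
    ext i j
    rcases eq_or_ne i j with rfl | hij
    · simp [Matrix.toSquareBlock_def, hd]
    · rw [Matrix.one_apply_ne hij, Matrix.toSquareBlock_def]
      by_contra h
      have := hM i j (fun e => hij (Subtype.ext e)) h
      rw [i.2, j.2] at this
      exact lt_irrefl _ this
  rw [this, Matrix.det_one]

theorem List.natCard_length_succ {α : Type*} [Fintype α] (n : ℕ) (Q : List α → Prop) :
    Nat.card {p : List α // p.length = n + 1 ∧ Q p} =
      ∑ a, Nat.card {p : List α // p.length = n ∧ Q (a :: p)} := by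
  have hfin (a : α) : Finite {p : List α // p.length = n ∧ Q (a :: p)} :=
    ((List.finite_length_eq α n).subset fun p hp => hp.1).to_subtype
  rw [← Nat.card_sigma]
  refine (Nat.card_eq_of_bijective
    (fun x : (a : α) × {p : List α // p.length = n ∧ Q (a :: p)} =>
      (⟨x.1 :: x.2.1, by simp [x.2.2.1], x.2.2.2⟩ : {p : List α // p.length = n + 1 ∧ Q p}))
    ⟨?_, ?_⟩).symm
  · rintro ⟨a, p, hp⟩ ⟨b, r, hr⟩ h
    simp only [Subtype.mk.injEq, List.cons.injEq] at h
    obtain ⟨rfl, rfl⟩ := h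
    rfl
  · rintro ⟨p, hl, hp⟩
    cases p with
    | nil => simp at hl
    | cons a p => exact ⟨⟨a, p, by simpa using hl, hp⟩, rfl⟩

namespace QuivRel

open Polynomial

variable (G : QuivRel)

/-- `G.Comp a b` means that the path `ab` exists and is nonzero. -/
def Comp (a b : G.A) : Prop := G.tgt a = G.src b ∧ ¬ G.rel a b

open Classical in
/-- Incidence matrix of starting vertices of those arrows which satisfy `P`. -/
noncomputable def srcMat (P : G.A → Prop) : Matrix G.V G.A ℤ[X] :=
  fun v a => if G.src a = v ∧ P a then 1 else 0

/-- Incidence matrix of end vertices of arrows. -/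
noncomputable def tgtMat : Matrix G.A G.V ℤ[X] := fun a v => if G.tgt a = v then 1 else 0

open Classical in
/-- Adjacency matrix of arrows with nonzero composition. -/
noncomputable def compMat : Matrix G.A G.A ℤ[X] := fun a b => if G.Comp a b then 1 else 0

/-- Generating function of nonzero paths of length between `1` and `N`
with given first arrow and given end point. -/
noncomputable def pathMat (N : ℕ) : Matrix G.A G.V ℤ[X] :=
  ∑ n ∈ Finset.range N, (X ^ (n + 1) : ℤ[X]) • (G.compMat ^ n * G.tgtMat)

/-- The maximal number of arrows which can precede `a` in a nonzero path. -/
noncomputable def height (a : G.A) : ℕ := sSup {n | ∃ p, G.IsNonzeroPath (p ++ [a]) ∧ p.length = n}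

variable {G}

theorem FinDim.height_lt (hfd : G.FinDim) {a b : G.A} (h : G.Comp a b) :
    G.height a < G.height b := by
  obtain ⟨N, hN⟩ := hfd
  have hbdd (c : G.A) : BddAbove {n | ∃ p, G.IsNonzeroPath (p ++ [c]) ∧ p.length = n} := by
    refine ⟨N, ?_⟩
    rintro _ ⟨p, hp, rfl⟩
    have := hN _ hp
    simp only [List.length_append, List.length_singleton] at this
    omega
  obtain ⟨p, hp, hl⟩ : G.height a ∈ {n | ∃ p, G.IsNonzeroPath (p ++ [a]) ∧ p.length = n} :=
    Nat.sSup_mem ⟨0, [], List.isChain_singleton _, rfl⟩ (hbdd a)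
  refine Nat.lt_of_succ_le (le_csSup (hbdd b) ⟨p ++ [a], ?_, by simp [hl]⟩)
  exact List.IsChain.append hp (List.isChain_singleton _) (by simpa [Comp] using h)

theorem natCard_paths_from_arrow (n : ℕ) (a : G.A) (j : G.V) :
    (Nat.card {p : List G.A // p.length = n ∧ G.IsNonzeroPath (a :: p) ∧
      ∀ x ∈ (a :: p).getLast?, G.tgt x = j} : ℤ[X]) = (G.compMat ^ n * G.tgtMat) a j := by
  classical
  induction n generalizing a with
  | zero =>
    rw [pow_zero, Matrix.one_mul, tgtMat]
    split_ifs with h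
    · rw [Nat.cast_eq_one, Nat.card_eq_one_iff_unique]
      refine ⟨⟨?_⟩, ⟨[], rfl, List.isChain_singleton _, by simpa using h⟩⟩
      rintro ⟨p, hp, -⟩ ⟨r, hr, -⟩
      simp [List.length_eq_zero_iff.1 hp, List.length_eq_zero_iff.1 hr]
    · rw [Nat.cast_eq_zero, Nat.card_eq_zero]
      left
      refine ⟨?_⟩
      rintro ⟨p, hp, -, hj⟩
      rw [List.length_eq_zero_iff.1 hp] at hj
      exact h (hj a rfl)
  | succ n ih =>
    rw [List.natCard_length_succ, pow_succ', Matrix.mul_assoc, Matrix.mul_apply, Nat.cast_sum]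
    refine Finset.sum_congr rfl fun b _ => ?_
    rw [← ih, compMat]
    split_ifs with h
    · rw [one_mul]
      have e (p : List G.A) : G.IsNonzeroPath (a :: b :: p) ↔ G.IsNonzeroPath (b :: p) := by
        rw [IsNonzeroPath, List.Chain', List.isChain_cons_cons]
        exact and_iff_right h
      simp only [e, List.getLast?_cons_cons]
    · rw [zero_mul, Nat.cast_eq_zero, Nat.card_eq_zero]
      left
      refine ⟨?_⟩
      rintro ⟨p, -, hp, -⟩
      rw [IsNonzeroPath, List.Chain', List.isChain_cons_cons] at hp
      exact h hp.1

theorem natCard_paths_zero (i j : G.V) :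
    (Nat.card {p : List G.A // p.length = 0 ∧ G.IsNonzeroPathFrom i j p} : ℤ[X]) =
      (1 : Matrix G.V G.V ℤ[X]) i j := by
  rw [Matrix.one_apply]
  split_ifs with h
  · rw [Nat.cast_eq_one, Nat.card_eq_one_iff_unique]
    refine ⟨⟨?_⟩, ⟨[], rfl, List.isChain_nil, by simp, by simp, fun _ => h⟩⟩
    rintro ⟨p, hp, -⟩ ⟨r, hr, -⟩
    simp [List.length_eq_zero_iff.1 hp, List.length_eq_zero_iff.1 hr]
  · rw [Nat.cast_eq_zero, Nat.card_eq_zero]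
    left
    refine ⟨?_⟩
    rintro ⟨p, hp, -, -, -, hj⟩
    exact h (hj (List.length_eq_zero_iff.1 hp))

theorem natCard_paths_succ (n : ℕ) (i j : G.V) :
    (Nat.card {p : List G.A // p.length = n + 1 ∧ G.IsNonzeroPathFrom i j p} : ℤ[X]) =
      (G.srcMat (fun _ => True) * (G.compMat ^ n * G.tgtMat)) i j := by
  classical
  rw [List.natCard_length_succ, Matrix.mul_apply, Nat.cast_sum]
  refine Finset.sum_congr rfl fun a _ => ?_
  rw [← natCard_paths_from_arrow, srcMat]
  split_ifs with h
  · rw [one_mul]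
    simp only [IsNonzeroPathFrom, List.head?_cons, Option.mem_some_iff, forall_eq', h.1,
      reduceCtorEq, false_imp_iff, and_true, true_and]
  · rw [zero_mul, Nat.cast_eq_zero, Nat.card_eq_zero]
    left
    refine ⟨?_⟩
    rintro ⟨p, -, -, hp, -⟩
    exact h ⟨hp a rfl, trivial⟩

/-- Beyond the maximal length `N`, no nonzero paths contribute. -/
theorem compMat_pow_mul_tgtMat {N : ℕ} (hN : ∀ p : List G.A, G.IsNonzeroPath p → p.length ≤ N)
    {n : ℕ} (hn : N ≤ n) : G.compMat ^ n * G.tgtMat = 0 := by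
  ext1 a j
  rw [← natCard_paths_from_arrow, Matrix.zero_apply, Nat.cast_eq_zero, Nat.card_eq_zero]
  left
  refine ⟨?_⟩
  rintro ⟨p, hl, hp, -⟩
  have := hN _ hp
  simp only [List.length_cons] at this
  omega

theorem qCartan_eq {N : ℕ} (hN : ∀ p : List G.A, G.IsNonzeroPath p → p.length ≤ N) :
    G.qCartan = 1 + G.srcMat (fun _ => True) * G.pathMat N := by
  ext1 i j
  rw [qCartan, finsum_eq_sum_of_support_subset (s := Finset.range (N + 1)), Finset.sum_range_succ',
    natCard_paths_zero, pow_zero, mul_one, add_comm, Matrix.add_apply, pathMat, Matrix.mul_sum,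
    Matrix.sum_apply]
  · congr 1
    refine Finset.sum_congr rfl fun n _ => ?_
    rw [natCard_paths_succ, Matrix.mul_smul, Matrix.smul_apply, smul_eq_mul, mul_comm]
  · intro n hn
    by_contra h
    obtain ⟨m, rfl⟩ : ∃ m, n = m + 1 := ⟨n - 1, by simp at h; omega⟩
    rw [Function.mem_support, natCard_paths_succ, compMat_pow_mul_tgtMat hN (by simp at h; omega),
      Matrix.mul_zero, Matrix.zero_apply, zero_mul] at hn
    exact hn rfl

theorem one_sub_mul_pathMat {N : ℕ}
    (hN : ∀ p : List G.A, G.IsNonzeroPath p → p.length ≤ N) :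
    (1 - (X : ℤ[X]) • G.compMat) * G.pathMat N = (X : ℤ[X]) • G.tgtMat := by
  have key (n : ℕ) : (1 - (X : ℤ[X]) • G.compMat) * ((X ^ (n + 1) : ℤ[X]) •
      (G.compMat ^ n * G.tgtMat)) = (X ^ (n + 1) : ℤ[X]) • (G.compMat ^ n * G.tgtMat) -
        (X ^ (n + 1 + 1) : ℤ[X]) • (G.compMat ^ (n + 1) * G.tgtMat) := by
    rw [Matrix.sub_mul, Matrix.one_mul, Matrix.mul_smul, Matrix.smul_mul, smul_smul,
      ← Matrix.mul_assoc,
      ← pow_succ', ← pow_succ]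
  rw [pathMat, Matrix.mul_sum, Finset.sum_congr rfl fun n _ => key n,
    Finset.sum_range_sub' (fun n => (X ^ (n + 1) : ℤ[X]) • (G.compMat ^ n * G.tgtMat)),
    compMat_pow_mul_tgtMat hN le_rfl]
  simp

theorem pathMat_eq {N : ℕ}
    (hN : ∀ p : List G.A, G.IsNonzeroPath p → p.length ≤ N) :
    G.pathMat N = (X : ℤ[X]) • (G.tgtMat + G.compMat * G.pathMat N) := by
  have := one_sub_mul_pathMat hN
  rw [Matrix.sub_mul, Matrix.one_mul, Matrix.smul_mul, sub_eq_iff_eq_add] at this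
  rw [smul_add, ← this]

theorem det_one_sub_compMat (hfd : G.FinDim) : (1 - (X : ℤ[X]) • G.compMat).det = 1 := by
  have h0 (a : G.A) : ¬ G.Comp a a := fun h => lt_irrefl _ (hfd.height_lt h)
  refine Matrix.det_eq_one_of_rank G.height (fun a => by simp [compMat, h0]) ?_
  intro a b hab h
  refine hfd.height_lt (not_not.1 fun hc => h ?_)
  simp [compMat, hc, hab]

variable (G) in
open Classical in
/-- The arrow following `a` in a relation, with junk value `a` if there is none. -/
noncomputable def next (a : G.A) : G.A := if h : ∃ b, G.rel a b then h.choose else a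

/-- `a` starts an infinite sequence of consecutive relations. -/
def Cyclic (a : G.A) : Prop := ∀ i, G.rel (G.next^[i] a) (G.next^[i + 1] a)

/-- The arrows reached from `a` by following relations. -/
def orbit (a : G.A) : Set G.A := {b | ∃ n, G.next^[n] a = b}

/-- An arrow of minimal height on the orbit of `a`, depending only on the orbit. -/
noncomputable def root (a : G.A) : G.A := Function.argminOn G.height (orbit a) ⟨a, 0, rfl⟩

/-- The distinguished arrows: one on each cycle with full zero relations. -/
def IsRoot (a : G.A) : Prop := Cyclic a ∧ root a = a

theorem next_eq (hf : ∀ a b c : G.A, G.rel a b → G.rel a c → b = c) {a b : G.A}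
    (h : G.rel a b) : G.next a = b := by
  have h' : ∃ b, G.rel a b := ⟨b, h⟩
  rw [next, dif_pos h']
  exact hf _ _ _ h'.choose_spec h

theorem Cyclic.rel_next {a : G.A} (h : Cyclic a) : G.rel a (G.next a) := h 0

theorem Cyclic.next {a : G.A} (h : Cyclic a) : Cyclic (G.next a) := fun i => by
  simpa only [← Function.iterate_succ_apply] using h (i + 1)

theorem Cyclic.iterate {a : G.A} (h : Cyclic a) (n : ℕ) : Cyclic (G.next^[n] a) := by
  induction n with
  | zero => exact h
  | succ n ih => rw [Function.iterate_succ_apply']; exact ih.next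

theorem cyclic_iff_of_rel (hf : ∀ a b c : G.A, G.rel a b → G.rel a c → b = c) {a b : G.A}
    (h : G.rel a b) : Cyclic a ↔ Cyclic b := by
  have e := next_eq hf h
  refine ⟨fun ha => e ▸ ha.next, fun hb i => ?_⟩
  cases i with
  | zero => simpa [e] using h
  | succ i => simpa only [Function.iterate_succ_apply, e] using hb i

theorem Cyclic.mem_periodicPts (hb : ∀ a b c : G.A, G.rel b a → G.rel c a → b = c) {a : G.A}
    (h : Cyclic a) : a ∈ Function.periodicPts G.next := by
  have key (i n : ℕ) (e : G.next^[i] a = G.next^[i + n] a) : a = G.next^[n] a := by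
    induction i with
    | zero => simpa using e
    | succ i ih =>
      refine ih (hb _ _ _ (h i) ?_)
      rw [e, Nat.add_right_comm]
      exact h (i + n)
  obtain ⟨i, j, hij, e⟩ := Finite.exists_ne_map_eq_of_infinite (fun i : ℕ => G.next^[i] a)
  wlog hlt : i < j generalizing i j
  · exact this j i hij.symm e.symm (by omega)
  obtain ⟨n, rfl⟩ := Nat.exists_eq_add_of_lt hlt
  exact Function.mk_mem_periodicPts (n := n + 1) (Nat.succ_pos _) (key i (n + 1) e).symm

theorem Cyclic.minimalPeriod_pos (hb : ∀ a b c : G.A, G.rel b a → G.rel c a → b = c) {a : G.A}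
    (h : Cyclic a) : 0 < Function.minimalPeriod G.next a :=
  Function.minimalPeriod_pos_of_mem_periodicPts (h.mem_periodicPts hb)

theorem Cyclic.orbit_next (hb : ∀ a b c : G.A, G.rel b a → G.rel c a → b = c) {a : G.A}
    (h : Cyclic a) : orbit (G.next a) = orbit a := by
  ext b
  refine ⟨fun ⟨n, hn⟩ => ⟨n + 1, hn⟩, fun ⟨n, hn⟩ => ?_⟩
  obtain ⟨p, hp⟩ := Nat.exists_eq_add_of_lt (h.minimalPeriod_pos hb)
  refine ⟨n + p, ?_⟩
  have : G.next^[p + 1] a = a := by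
    rw [show p + 1 = Function.minimalPeriod G.next a by omega, Function.iterate_minimalPeriod]
  rw [Function.iterate_add_apply, ← Function.iterate_succ_apply, this, hn]

theorem Cyclic.orbit_iterate (hb : ∀ a b c : G.A, G.rel b a → G.rel c a → b = c) {a : G.A}
    (h : Cyclic a) (n : ℕ) : orbit (G.next^[n] a) = orbit a := by
  induction n with
  | zero => rfl
  | succ n ih => rw [Function.iterate_succ_apply', (h.iterate n).orbit_next hb, ih]

theorem root_congr {a b : G.A} (h : orbit a = orbit b) : root a = root b := by
  simp only [root, h]

theorem Cyclic.root_iterate (hb : ∀ a b c : G.A, G.rel b a → G.rel c a → b = c) {a : G.A}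
    (h : Cyclic a) (n : ℕ) : root (G.next^[n] a) = root a :=
  root_congr (h.orbit_iterate hb n)

theorem root_mem_orbit (a : G.A) : root a ∈ orbit a :=
  Function.argminOn_mem _ _ _

theorem height_root_le {a b : G.A} (h : b ∈ orbit a) : G.height (root a) ≤ G.height b :=
  Function.argminOn_le _ _ h

theorem Cyclic.isRoot_root (hb : ∀ a b c : G.A, G.rel b a → G.rel c a → b = c) {a : G.A}
    (h : Cyclic a) : IsRoot (root a) := by
  obtain ⟨n, hn⟩ := root_mem_orbit a
  rw [← hn]
  exact ⟨h.iterate n, (h.root_iterate hb n).trans hn.symm⟩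

theorem IsRoot.height_le {a : G.A} (h : IsRoot a) (n : ℕ) :
    G.height a ≤ G.height (G.next^[n] a) := by
  conv_lhs => rw [← h.2]
  exact height_root_le ⟨n, rfl⟩

theorem IsRoot.eq_of_iterate (hb : ∀ a b c : G.A, G.rel b a → G.rel c a → b = c) {a b : G.A}
    (ha : IsRoot a) (h : IsRoot b) {n : ℕ} (e : G.next^[n] a = b) : a = b := by
  rw [← ha.2, ← h.2, ← e, ha.1.root_iterate hb]

theorem src_iterate_succ {a : G.A} (h : Cyclic a) (n : ℕ) :
    G.src (G.next^[n + 1] a) = G.tgt (G.next^[n] a) :=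
  (G.rel_comp _ _ (h n)).symm

/-- If the cycle of the root `a` enters the start of another arrow `b`, then `b` is higher. -/
theorem IsRoot.height_lt (hfd : G.FinDim)
    (hf : ∀ a b c : G.A, G.rel a b → G.rel a c → b = c) {a b : G.A}
    (ha : IsRoot a) {n : ℕ} (e : G.src (G.next^[n + 1] a) = G.src b)
    (hne : G.next^[n + 1] a ≠ b) : G.height a < G.height b := by
  refine (ha.height_le n).trans_lt (hfd.height_lt ⟨?_, fun hr => hne ?_⟩)
  · rw [← e, src_iterate_succ ha.1]
  · exact hf _ _ _ (ha.1 n) hr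

theorem IsRoot.eq_of_src_eq (hfd : G.FinDim)
    (hf : ∀ a b c : G.A, G.rel a b → G.rel a c → b = c)
    (hb : ∀ a b c : G.A, G.rel b a → G.rel c a → b = c) {a b : G.A}
    (ha : IsRoot a) (h : IsRoot b) (e : G.src a = G.src b) : a = b := by
  have key {a b : G.A} (ha : IsRoot a) (h : IsRoot b) (e : G.src a = G.src b) (hne : a ≠ b) :
      G.height a < G.height b := by
    obtain ⟨p, hp⟩ := Nat.exists_eq_add_of_lt (ha.1.minimalPeriod_pos hb)
    have : G.next^[p + 1] a = a := by
      rw [show p + 1 = Function.minimalPeriod G.next a by omega, Function.iterate_minimalPeriod]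
    exact ha.height_lt hfd hf (n := p) (by rw [this, e]) (by rwa [this])
  by_contra hne
  exact lt_asymm (key ha h e hne) (key h ha e.symm (Ne.symm hne))

/-- The first `k` arrows reached from `a` by following relations. -/
noncomputable def relPath (k : ℕ) (a : G.A) : List G.A := (List.range k).map fun i => G.next^[i] a

theorem Cyclic.isMinZeroCycle_relPath (hb : ∀ a b c : G.A, G.rel b a → G.rel c a → b = c) {a : G.A}
    (h : Cyclic a) {k : ℕ} (hk : Function.minimalPeriod G.next a = k) :
    G.IsMinZeroCycle (relPath k a) := by
  have h0 := h.minimalPeriod_pos hb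
  refine ⟨⟨?_, fun i => ?_⟩, ?_⟩
  · intro e
    have := congrArg List.length e
    simp only [relPath, List.length_map, List.length_range, List.length_nil] at this
    omega
  · have := h i
    rw [← Function.iterate_mod_minimalPeriod_eq (n := i + 1)] at this
    have hget (j : Fin (relPath k a).length) : (relPath k a).get j = G.next^[j] a := by
      rw [List.get_eq_getElem]
      simp [relPath]
    rw [hget, hget]
    simpa [relPath, hk] using this
  · refine List.nodup_range.map_on fun i hi j hj e => ?_
    subst hk
    exact Function.iterate_injOn_Iio_minimalPeriod (by simpa using hi) (by simpa using hj) e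

theorem IsMinZeroCycle.eq_relPath (hf : ∀ a b c : G.A, G.rel a b → G.rel a c → b = c)
    {p : List G.A} (hp : G.IsMinZeroCycle p) :
    ∃ a, Cyclic a ∧ Function.minimalPeriod G.next a = p.length ∧ p = relPath p.length a := by
  have hl : 0 < p.length := List.length_pos_iff.2 hp.1.1
  have hget (i : ℕ) : G.next^[i] (p[0]) = p[i % p.length]'(Nat.mod_lt _ hl) := by
    induction i with
    | zero => simp
    | succ i ih =>
      rw [Function.iterate_succ_apply', ih]
      have := next_eq hf (hp.1.2 ⟨i % p.length, Nat.mod_lt _ hl⟩)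
      simpa using this
  have hper : Function.IsPeriodicPt G.next p.length p[0] := by
    rw [Function.IsPeriodicPt, Function.IsFixedPt, hget]
    simp
  refine ⟨p[0], fun i => ?_, ?_, ?_⟩
  · rw [hget, hget]
    simpa using hp.1.2 ⟨i % p.length, Nat.mod_lt _ hl⟩
  · refine le_antisymm (hper.minimalPeriod_le hl) ?_
    by_contra! hlt
    have h0 : 0 < Function.minimalPeriod G.next p[0] := hper.minimalPeriod_pos hl
    have e : G.next^[Function.minimalPeriod G.next p[0]] p[0] = p[0] :=
      Function.iterate_minimalPeriod
    rw [hget, hp.2.getElem_inj_iff, Nat.mod_eq_of_lt hlt] at e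
    omega
  · refine List.ext_getElem (by simp [relPath]) fun i h1 h2 => ?_
    simp [relPath, hget, Nat.mod_eq_of_lt h1]

theorem relPath_iterate_isRotated {a : G.A} {k : ℕ} (hk : G.next^[k] a = a) (n : ℕ) :
    relPath k (G.next^[n] a) ~r relPath k a := by
  induction n with
  | zero => rfl
  | succ n ih =>
    refine List.IsRotated.trans ?_ ih
    have hk' : G.next^[k] (G.next^[n] a) = G.next^[n] a := by
      rw [← Function.iterate_add_apply, add_comm, Function.iterate_add_apply, hk]
    rw [Function.iterate_succ_apply']
    generalize G.next^[n] a = b at hk'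
    refine List.IsRotated.symm ⟨1, ?_⟩
    cases k with
    | zero => rfl
    | succ k =>
      have e : relPath (k + 1) b = b :: (List.range k).map fun i => G.next^[i] (G.next b) := by
        simp [relPath, List.range_succ_eq_map, Function.comp_def]
      rw [e, List.rotate_cons_succ, List.rotate_zero, relPath, List.range_succ, List.map_append,
        List.map_singleton, ← Function.iterate_succ_apply, hk']

theorem numCycles_eq (hf : ∀ a b c : G.A, G.rel a b → G.rel a c → b = c)
    (hb : ∀ a b c : G.A, G.rel b a → G.rel c a → b = c) (k : ℕ) :
    G.numCycles k = Nat.card {a : G.A // IsRoot a ∧ Function.minimalPeriod G.next a = k} := by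
  refine (Nat.card_eq_of_bijective (fun a : {a : G.A // IsRoot a ∧
    Function.minimalPeriod G.next a = k} => (Quotient.mk (G.cycleSetoid
      (fun p => G.IsMinZeroCycle p ∧ p.length = k)) ⟨relPath k a.1,
        a.2.1.1.isMinZeroCycle_relPath hb a.2.2, by simp [relPath]⟩)) ⟨?_, ?_⟩).symm
  · rintro ⟨a, ha, hk⟩ ⟨b, hb', hk'⟩ e
    have hr : relPath k a ~r relPath k b := Quotient.exact e
    have h0 := hb'.1.minimalPeriod_pos hb
    have hm : b ∈ relPath k a := by
      rw [hr.mem_iff]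
      exact List.mem_map.2 ⟨0, by simp; omega, rfl⟩
    obtain ⟨n, -, hn⟩ := List.mem_map.1 hm
    exact Subtype.ext (ha.eq_of_iterate hb hb' hn)
  · intro z
    induction z using Quotient.inductionOn with
    | h z =>
      obtain ⟨p, hp, hk⟩ := z
      obtain ⟨a, ha, hm, he⟩ := hp.eq_relPath hf
      obtain ⟨n, hn⟩ := root_mem_orbit a
      have hper : G.next^[k] a = a := by
        rw [← hk, ← hm, Function.iterate_minimalPeriod]
      refine ⟨⟨root a, ha.isRoot_root hb, ?_⟩, Quotient.sound ?_⟩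
      · rw [← hn, Function.minimalPeriod_apply_iterate (ha.mem_periodicPts hb), hm, hk]
      · change relPath k (root a) ~r p
        rw [he, hk, ← hn]
        exact relPath_iterate_isRotated hper n

/-- The predicted diagonal entry at `v`. -/
noncomputable def diagEntry (v : G.V) : ℤ[X] :=
  open Classical in
  if h : ∃ a, IsRoot a ∧ G.src a = v then 1 - (-X) ^ Function.minimalPeriod G.next h.choose else 1

open Classical in
/-- The row transformation: at the start of a root, the alternating sum over its cycle. -/
noncomputable def rowMat (G : QuivRel) : Matrix G.V G.V ℤ[X] := fun v u =>
  if h : ∃ a, IsRoot a ∧ G.src a = v then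
    ∑ i ∈ Finset.range (Function.minimalPeriod G.next h.choose),
      (-X) ^ i * (1 : Matrix G.V G.V ℤ[X]) (G.src (G.next^[i] h.choose)) u
  else (1 : Matrix G.V G.V ℤ[X]) v u

theorem exists_eq_of_src (hfd : G.FinDim) (hG : G.Gentle) {a : G.A} (ha : IsRoot a)
    (h : ∃ b, IsRoot b ∧ G.src b = G.src a) : h.choose = a :=
  h.choose_spec.1.eq_of_src_eq hfd hG.2.1 hG.2.2 ha h.choose_spec.2

theorem diagEntry_src (hfd : G.FinDim) (hG : G.Gentle) {a : G.A} (ha : IsRoot a) :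
    diagEntry (G.src a) = 1 - (-X) ^ Function.minimalPeriod G.next a := by
  have h : ∃ b, IsRoot b ∧ G.src b = G.src a := ⟨a, ha, rfl⟩
  rw [diagEntry, dif_pos h, exists_eq_of_src hfd hG ha h]

theorem rowMat_src (hfd : G.FinDim) (hG : G.Gentle) {a : G.A} (ha : IsRoot a) (u : G.V) :
    G.rowMat (G.src a) u = ∑ i ∈ Finset.range (Function.minimalPeriod G.next a),
      (-X) ^ i * (1 : Matrix G.V G.V ℤ[X]) (G.src (G.next^[i] a)) u := by
  have h : ∃ b, IsRoot b ∧ G.src b = G.src a := ⟨a, ha, rfl⟩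
  rw [rowMat, dif_pos h, exists_eq_of_src hfd hG ha h]

theorem det_rowMat (hfd : G.FinDim) (hG : G.Gentle) : G.rowMat.det = 1 := by
  classical
  let b : G.V → WithTop ℕ := fun v =>
    if h : ∃ a, IsRoot a ∧ G.src a = v then (G.height h.choose : WithTop ℕ) else ⊤
  have b_src {a : G.A} (ha : IsRoot a) : b (G.src a) = G.height a := by
    have h : ∃ b, IsRoot b ∧ G.src b = G.src a := ⟨a, ha, rfl⟩
    simp only [b]
    rw [dif_pos h, exists_eq_of_src hfd hG ha h]
  have key {a : G.A} (ha : IsRoot a) {i : ℕ} (h0 : 0 < i)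
      (hi : i < Function.minimalPeriod G.next a) : b (G.src a) < b (G.src (G.next^[i] a)) := by
    rw [b_src ha]
    by_cases h : ∃ c, IsRoot c ∧ G.src c = G.src (G.next^[i] a)
    · obtain ⟨c, hc, e⟩ := h
      rw [← e, b_src hc, Nat.cast_lt]
      obtain ⟨n, rfl⟩ := Nat.exists_eq_add_of_lt h0
      rw [zero_add] at e hi
      refine ha.height_lt hfd hG.2.1 e.symm fun hac => ?_
      have := ha.eq_of_iterate hG.2.2 hc hac
      rw [← this] at hac
      exact absurd (Function.IsPeriodicPt.minimalPeriod_le (Nat.succ_pos n) hac) (by omega)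
    · simp only [b]
      rw [dif_neg h]
      exact WithTop.coe_lt_top _
  refine Matrix.det_eq_one_of_rank b (fun v => ?_) fun v u hvu hM => ?_
  · by_cases h : ∃ a, IsRoot a ∧ G.src a = v
    · obtain ⟨a, ha, rfl⟩ := h
      rw [rowMat_src hfd hG ha, Finset.sum_eq_single_of_mem 0]
      · rw [pow_zero, one_mul]
        exact Matrix.one_apply_eq _
      · exact Finset.mem_range.2 (ha.1.minimalPeriod_pos hG.2.2)
      · intro i hi h0
        rw [Matrix.one_apply_ne, mul_zero]
        exact fun e => (key ha (Nat.pos_of_ne_zero h0) (Finset.mem_range.1 hi)).ne (by rw [e])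
    · rw [rowMat, dif_neg h, Matrix.one_apply_eq]
  · by_cases h : ∃ a, IsRoot a ∧ G.src a = v
    · obtain ⟨a, ha, rfl⟩ := h
      rw [rowMat_src hfd hG ha] at hM
      obtain ⟨i, hi, hne⟩ := Finset.exists_ne_zero_of_sum_ne_zero hM
      have e : G.src (G.next^[i] a) = u := by
        by_contra e
        rw [Matrix.one_apply_ne e, mul_zero] at hne
        exact hne rfl
      subst e
      refine key ha (Nat.pos_of_ne_zero ?_) (Finset.mem_range.1 hi)
      rintro rfl
      exact hvu rfl
    · rw [rowMat, dif_neg h, Matrix.one_apply_ne hvu] at hM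
      exact absurd rfl hM

/-- The relation which remains after trading, for each root, the relation
entering it for the nonzero composition entering it, admits no cycles. -/
theorem exists_rank (hfd : G.FinDim) (hG : G.Gentle) : ∃ r : G.A → ℕ ×ₗ ℕᵒᵈ, ∀ a b : G.A,
    (G.rel a b ∧ ¬ IsRoot b ∨ G.Comp a b ∧ IsRoot b) → r a < r b := by
  classical
  have hex (a : G.A) : ∃ i, ¬ (G.rel (G.next^[i] a) (G.next^[i + 1] a) ∧
      ¬ IsRoot (G.next^[i + 1] a)) := by
    by_contra! h
    have ha : Cyclic a := fun i => (h i).1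
    obtain ⟨n, hn⟩ := root_mem_orbit (G.next a)
    exact (h n).2 ((Function.iterate_succ_apply _ _ _).symm ▸ hn ▸ ha.next.isRoot_root hG.2.2)
  refine ⟨fun a => toLex (if Cyclic a then G.height (root a) + 1 else 0,
    OrderDual.toDual (Nat.find (hex a))), fun a b hab => ?_⟩
  rw [Prod.Lex.toLex_lt_toLex]
  rcases hab with ⟨hr, hb⟩ | ⟨hc, hb⟩
  · right
    have e := next_eq hG.2.1 hr
    constructor
    · simp only [cyclic_iff_of_rel hG.2.1 hr]
      split_ifs with h
      · rw [← e, root_congr (((cyclic_iff_of_rel hG.2.1 hr).2 h).orbit_next hG.2.2)]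
      · rfl
    · rw [OrderDual.toDual_lt_toDual]
      have hs := Nat.find_spec (hex a)
      cases hn : Nat.find (hex a) with
      | zero =>
        rw [hn] at hs
        exact absurd ⟨by simpa [e] using hr, by simpa [e] using hb⟩ hs
      | succ n =>
        rw [hn] at hs
        refine Nat.lt_succ_of_le (Nat.find_min' _ ?_)
        simpa only [Function.iterate_succ_apply, e] using hs
  · left
    dsimp only
    rw [if_pos hb.1, hb.2]
    split_ifs with h
    · exact Nat.succ_lt_succ ((height_root_le ⟨0, rfl⟩).trans_lt (hfd.height_lt hc))
    · exact Nat.succ_pos _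

/-- The generating function of nonzero paths of length at most `N` not starting with a root. -/
noncomputable def nonRootMat (G : QuivRel) (N : ℕ) : Matrix G.V G.V ℤ[X] :=
  1 + G.srcMat (fun a => ¬ IsRoot a) * G.pathMat N

theorem det_nonRootMat (hfd : G.FinDim) (hG : G.Gentle) {N : ℕ}
    (hN : ∀ p : List G.A, G.IsNonzeroPath p → p.length ≤ N) :
    (G.nonRootMat N).det = 1 := by
  classical
  rw [nonRootMat, Matrix.det_one_add_mul_comm, ← one_mul (Matrix.det _),
    ← det_one_sub_compMat hfd, ← Matrix.det_mul, Matrix.mul_add, ← Matrix.mul_assoc,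
    one_sub_mul_pathMat hN, Matrix.mul_one,
    det_one_sub_compMat hfd]
  have entry (a b : G.A) : (1 - (X : ℤ[X]) • G.compMat +
      (X : ℤ[X]) • G.tgtMat * G.srcMat (fun a => ¬ IsRoot a) : Matrix G.A G.A ℤ[X]) a b =
        (1 : Matrix G.A G.A ℤ[X]) a b + X * ((if G.tgt a = G.src b ∧ ¬ IsRoot b then 1 else 0) -
          if G.Comp a b then 1 else 0) := by
    have : (G.tgtMat * G.srcMat (fun a => ¬ IsRoot a)) a b =
        if G.tgt a = G.src b ∧ ¬ IsRoot b then 1 else 0 := by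
      rw [Matrix.mul_apply, Finset.sum_eq_single (G.tgt a)]
      · simp [tgtMat, srcMat, eq_comm]
      · intro v _ hv
        rw [tgtMat, if_neg hv.symm, zero_mul]
      · simp
    rw [Matrix.add_apply, Matrix.sub_apply, Matrix.smul_mul, Matrix.smul_apply,
      Matrix.smul_apply, this, compMat, smul_eq_mul, smul_eq_mul]
    ring
  have zero (a b : G.A) (h : ¬ (G.rel a b ∧ ¬ IsRoot b ∨ G.Comp a b ∧ IsRoot b)) :
      ((if G.tgt a = G.src b ∧ ¬ IsRoot b then 1 else 0) -
          if G.Comp a b then 1 else 0 : ℤ[X]) = 0 := by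
    have := G.rel_comp a b
    by_cases h1 : IsRoot b <;> by_cases h2 : G.rel a b <;> by_cases h3 : G.tgt a = G.src b <;>
      simp_all [Comp]
  obtain ⟨r, hr⟩ := exists_rank hfd hG
  refine Matrix.det_eq_one_of_rank r (fun a => ?_) fun a b hab h => hr a b ?_
  · rw [entry, zero a a fun h => lt_irrefl _ (hr a a h), mul_zero, add_zero, Matrix.one_apply_eq]
  · by_contra h'
    rw [entry, zero a b h', mul_zero, add_zero, Matrix.one_apply_ne hab] at h
    exact h rfl

theorem qCartan_apply {N : ℕ} (hN : ∀ p : List G.A, G.IsNonzeroPath p → p.length ≤ N) (v u : G.V) :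
    G.qCartan v u = G.nonRootMat N v u +
      (G.srcMat IsRoot * G.pathMat N) v u := by
  rw [qCartan_eq hN, nonRootMat, ← Matrix.add_apply, add_assoc, ← Matrix.add_mul]
  have : G.srcMat (fun _ => True) = G.srcMat (fun a => ¬ IsRoot a) + G.srcMat IsRoot := by
    ext1 v a
    by_cases h : IsRoot a <;> simp [srcMat, h]
  rw [this]

theorem srcMat_isRoot_mul (hfd : G.FinDim) (hG : G.Gentle) {a : G.A} (ha : IsRoot a)
    (M : Matrix G.A G.V ℤ[X]) (u : G.V) : (G.srcMat IsRoot * M) (G.src a) u = M a u := by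
  rw [Matrix.mul_apply, Finset.sum_eq_single a]
  · simp [srcMat, ha]
  · intro b _ hba
    rw [srcMat, if_neg, zero_mul]
    exact fun h => hba (h.2.eq_of_src_eq hfd hG.2.1 hG.2.2 ha h.1)
  · simp

/-- Prolonging paths by an arrow `a` in front: the result is either nonzero
or starts with the relation `a (next a)`. -/
theorem X_mul_qCartan_tgt (hG : G.Gentle) {N : ℕ}
    (hN : ∀ p : List G.A, G.IsNonzeroPath p → p.length ≤ N) {a : G.A}
    (ha : G.rel a (G.next a)) (u : G.V) :
    X * G.qCartan (G.tgt a) u = G.pathMat N a u + X * G.pathMat N (G.next a) u := by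
  classical
  have h1 := congrFun (congrFun (pathMat_eq hN) a) u
  have h2 : (G.srcMat (fun _ => True) * G.pathMat N) (G.tgt a) u =
      (G.compMat * G.pathMat N) a u + G.pathMat N (G.next a) u := by
    have : G.pathMat N (G.next a) u =
        ∑ b, (if b = G.next a then 1 else 0 : ℤ[X]) * G.pathMat N b u := by simp
    rw [this, Matrix.mul_apply, Matrix.mul_apply, ← Finset.sum_add_distrib]
    refine Finset.sum_congr rfl fun b _ => ?_
    rw [← add_mul]
    congr 1
    have hrel : G.rel a b ↔ b = G.next a :=
      ⟨fun h => (next_eq hG.2.1 h).symm, fun h => h ▸ ha⟩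
    have := G.rel_comp a b
    by_cases h : b = G.next a <;> by_cases h3 : G.src b = G.tgt a <;>
      simp_all [srcMat, compMat, Comp, eq_comm]
  rw [qCartan_eq hN, Matrix.add_apply, h2, h1, Matrix.smul_apply, Matrix.add_apply, smul_eq_mul,
    tgtMat, Matrix.one_apply]
  ring

theorem sum_qCartan_cycle (hG : G.Gentle) {N : ℕ}
    (hN : ∀ p : List G.A, G.IsNonzeroPath p → p.length ≤ N) {a : G.A} (ha : Cyclic a) (u : G.V) :
    ∑ i ∈ Finset.range (Function.minimalPeriod G.next a),
      (-X) ^ i * G.qCartan (G.src (G.next^[i] a)) u =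
        (1 - (-X) ^ Function.minimalPeriod G.next a) *
          (G.qCartan (G.src a) u - G.pathMat N a u) := by
  set k := Function.minimalPeriod G.next a with hk
  have hka : G.next^[k] a = a := Function.iterate_minimalPeriod
  have step (i : ℕ) : (-X) ^ (i + 1) * G.qCartan (G.src (G.next^[i + 1] a)) u =
      (-X) ^ (i + 1) * G.pathMat N (G.next^[i + 1] a) u - (-X) ^ i * G.pathMat N (G.next^[i] a) u := by
    have := X_mul_qCartan_tgt hG hN (ha.iterate i).rel_next u
    rw [← Function.iterate_succ_apply' G.next] at this
    rw [src_iterate_succ ha, pow_succ]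
    linear_combination (-(-X) ^ i) * this
  have tele := Finset.sum_range_sub (fun i => (-X) ^ i * G.pathMat N (G.next^[i] a) u) k
  rw [Finset.sum_congr rfl fun i _ => (step i).symm] at tele
  have h1 := Finset.sum_range_succ (fun i => (-X) ^ i * G.qCartan (G.src (G.next^[i] a)) u) k
  have h2 := Finset.sum_range_succ' (fun i => (-X) ^ i * G.qCartan (G.src (G.next^[i] a)) u) k
  simp only [hka, pow_zero, one_mul, Function.iterate_zero, id_eq] at tele h1 h2
  linear_combination h2 - h1 + tele

theorem rowMat_mul_qCartan (hfd : G.FinDim) (hG : G.Gentle) {N : ℕ}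
    (hN : ∀ p : List G.A, G.IsNonzeroPath p → p.length ≤ N) :
    G.rowMat * G.qCartan =
      Matrix.diagonal diagEntry * G.nonRootMat N := by
  ext1 v u
  rw [Matrix.diagonal_mul]
  by_cases h : ∃ a, IsRoot a ∧ G.src a = v
  · obtain ⟨a, ha, rfl⟩ := h
    have e : G.nonRootMat N (G.src a) u =
        G.qCartan (G.src a) u - G.pathMat N a u := by
      rw [qCartan_apply hN, srcMat_isRoot_mul hfd hG ha, add_sub_cancel_right]
    rw [diagEntry_src hfd hG ha, e, ← sum_qCartan_cycle hG hN ha.1, Matrix.mul_apply]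
    simp_rw [rowMat_src hfd hG ha, Finset.sum_mul]
    rw [Finset.sum_comm]
    refine Finset.sum_congr rfl fun i _ => ?_
    simp [Matrix.one_apply]
  · have e : (G.srcMat IsRoot * G.pathMat N) v u = 0 := by
      rw [Matrix.mul_apply]
      refine Finset.sum_eq_zero fun a _ => ?_
      rw [srcMat, if_neg (fun h' => h ⟨a, h'.2, h'.1⟩), zero_mul]
    rw [diagEntry, dif_neg h, one_mul, ← add_zero (G.nonRootMat N v u), ← e,
      ← qCartan_apply hN, Matrix.mul_apply]
    simp [rowMat, dif_neg h, Matrix.one_apply]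

theorem neg_X_pow_injective : Function.Injective fun k : ℕ => (-X : ℤ[X]) ^ k := by
  intro k l h
  simpa using congrArg natDegree h

theorem natCard_diagEntry_eq (hfd : G.FinDim) (hG : G.Gentle) (k : ℕ) :
    Nat.card {v : G.V // diagEntry v = 1 - (-X) ^ k} = G.numCycles k := by
  rw [numCycles_eq hG.2.1 hG.2.2]
  refine (Nat.card_eq_of_bijective (fun a : {a : G.A // IsRoot a ∧
    Function.minimalPeriod G.next a = k} => (⟨G.src a.1,
      (diagEntry_src hfd hG a.2.1).trans (by rw [a.2.2])⟩ :
      {v : G.V // diagEntry v = 1 - (-X) ^ k})) ⟨?_, ?_⟩).symm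
  · rintro ⟨a, ha, _⟩ ⟨b, hb, _⟩ e
    exact Subtype.ext (ha.eq_of_src_eq hfd hG.2.1 hG.2.2 hb (congrArg Subtype.val e))
  · rintro ⟨v, hv⟩
    by_cases h : ∃ a, IsRoot a ∧ G.src a = v
    · obtain ⟨a, ha, rfl⟩ := h
      refine ⟨⟨a, ha, neg_X_pow_injective ?_⟩, rfl⟩
      rw [diagEntry_src hfd hG ha] at hv
      exact sub_right_injective hv
    · rw [diagEntry, dif_neg h, eq_comm, sub_eq_self] at hv
      exact absurd hv (pow_ne_zero _ (neg_ne_zero.2 X_ne_zero))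

end QuivRel


/-- **Theorem 1.** Let `(Q,I)` be a gentle quiver and `A = KQ/I` the
corresponding (finite-dimensional) gentle algebra, and let `c_k` be the number
of minimal oriented `k`-cycles in `Q` with full zero relations.  Then the
`q`-Cartan matrix `C_A(q)` is unimodularly equivalent over `ℤ[q]` to a diagonal
matrix with entries `1 - (-q)^k` with multiplicity `c_k` for `k ≥ 1`, and all
further diagonal entries equal to `1`. -/
theorem qCartan_unimodEquiv_diagonal (G : QuivRel) (hG : G.Gentle) (hfd : G.FinDim) :
    ∃ d : G.V → Polynomial ℤ,
      UnimodEquiv G.qCartan (Matrix.diagonal d) ∧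
      (∀ k : ℕ, 1 ≤ k →
        Nat.card {v : G.V // d v = 1 - (- Polynomial.X) ^ k} = G.numCycles k) ∧
      (∀ v : G.V, (∀ k : ℕ, 1 ≤ k → d v ≠ 1 - (- Polynomial.X) ^ k) → d v = 1) := by
  obtain ⟨N, hN⟩ := hfd
  have hfd : G.FinDim := ⟨N, hN⟩
  have hdet := QuivRel.det_nonRootMat hfd hG hN
  refine ⟨QuivRel.diagEntry, ⟨G.rowMat, (G.nonRootMat N)⁻¹, QuivRel.det_rowMat hfd hG, ?_, ?_⟩,
    fun k _ => QuivRel.natCard_diagEntry_eq hfd hG k, fun v hv => ?_⟩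
  · rw [Matrix.det_nonsing_inv, hdet, Ring.inverse_one]
  · rw [QuivRel.rowMat_mul_qCartan hfd hG hN, Matrix.mul_assoc, Matrix.mul_nonsing_inv _
      (hdet ▸ isUnit_one), Matrix.mul_one]
  · by_cases h : ∃ a, QuivRel.IsRoot a ∧ G.src a = v
    · obtain ⟨a, ha, rfl⟩ := h
      exact absurd (QuivRel.diagEntry_src hfd hG ha) (hv _ (ha.1.minimalPeriod_pos hG.2.2))
    · rw [QuivRel.diagEntry, dif_neg h]
end

section
/- Let (Q,I) be a gentle quiver, K a field, and A = KQ/I the corresponding gentle algebra. For each k ≥ 1 let c_k denote the number of minimal oriented k-cycles in Q with full zero relations. Then the determinant of the q-Cartan matrix satisfies det C_A(q) = ∏_{k ≥ 1} (1 − (−q)^k)^{c_k}. -/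
/-- The determinant of `1 + D P`, where `D` is diagonal and `P` is the matrix of a permutation
acting transitively. -/
theorem Matrix.det_one_add_of_transitive_perm {S R : Type*} [Fintype S] [DecidableEq S] [CommRing R]
    [Nonempty S] (τ : Equiv.Perm S) (hτ : ∀ x y, τ.SameCycle x y) (d : S → R) :
    (1 + Matrix.of fun a b => if τ a = b then d a else 0).det = 1 - ∏ a, -d a := by
  rcases subsingleton_or_nontrivial S with hS | hS
  · obtain ⟨x⟩ := ‹Nonempty S›
    let : Unique S := ⟨⟨x⟩, fun y => Subsingleton.elim _ _⟩
    rw [Matrix.det_unique]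
    simp [Subsingleton.elim (τ default) default]
  · have hmove : ∀ x, τ x ≠ x := by
      intro x hx
      obtain ⟨y, hy⟩ := exists_ne x
      obtain ⟨n, hn⟩ := (hτ x y).exists_nat_pow_eq
      rw [Equiv.Perm.pow_apply_eq_self_of_apply_eq_self hx] at hn
      exact hy hn.symm
    have hcycle : τ.IsCycle := by
      obtain ⟨x⟩ := ‹Nonempty S›
      exact ⟨x, hmove x, fun y _ => hτ x y⟩
    have hsupp : τ.support = Finset.univ := by
      ext x
      simp [hmove x]
    have hne : (1 : Equiv.Perm S) ≠ τ := by
      rintro rfl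
      obtain ⟨x⟩ := ‹Nonempty S›
      exact hmove x rfl
    rw [← Matrix.det_transpose, Matrix.det_apply']
    rw [← Finset.sum_subset (Finset.subset_univ {1, τ})]
    · rw [Finset.sum_pair hne, hcycle.sign, hsupp, Finset.prod_neg]
      simp [hmove, fun x => (hmove x).symm, sub_eq_add_neg]
    · intro π _ hπ
      suffices ∃ i, π i ≠ i ∧ π i ≠ τ i by
        obtain ⟨i, hi, hi'⟩ := this
        rw [Finset.prod_eq_zero (Finset.mem_univ i), mul_zero]
        simp [hi.symm, hi'.symm]
      by_contra! h
      simp only [Finset.mem_insert, Finset.mem_singleton, not_or] at hπ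
      obtain ⟨x, hx⟩ : ∃ x, π x ≠ x := by
        by_contra! h1
        exact hπ.1 (Equiv.ext h1)
      have hiter : ∀ n : ℕ, π ((τ ^ n) x) ≠ (τ ^ n) x := by
        intro n
        induction n with
        | zero => simpa using hx
        | succ n ih =>
          rw [pow_succ', Equiv.Perm.mul_apply, ← h _ ih]
          exact fun h1 => ih (π.injective h1)
      refine hπ.2 (Equiv.ext fun y => ?_)
      obtain ⟨n, rfl⟩ := (hτ x y).exists_nat_pow_eq
      exact h _ (hiter n)

/-- The determinant of `1 + D P`, where `D` is diagonal and `P` is a permutation matrix, is a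
product over the orbits of the permutation. -/
theorem Matrix.det_one_add_perm {S R : Type*} [Fintype S] [DecidableEq S] [CommRing R]
    (σ : Equiv.Perm S) [Fintype (Quotient (Equiv.Perm.SameCycle.setoid σ))]
    [∀ c : Quotient (Equiv.Perm.SameCycle.setoid σ), Fintype {a // Quotient.mk _ a = c}]
    (d : S → R) :
    (1 + Matrix.of fun a b => if σ a = b then d a else 0).det =
      ∏ c : Quotient (Equiv.Perm.SameCycle.setoid σ),
        (1 - ∏ a : {a // Quotient.mk _ a = c}, -d a) := by
  classical
  let s := Equiv.Perm.SameCycle.setoid σ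
  let e := Fintype.equivFin (Quotient s)
  let b : S → Fin (Fintype.card (Quotient s)) := fun a => e (Quotient.mk s a)
  have hσ : ∀ a, Quotient.mk s (σ a) = Quotient.mk s a := fun a =>
    Quotient.sound (Equiv.Perm.sameCycle_apply_left.2 (Equiv.Perm.SameCycle.refl σ a))
  have htri : (1 + Matrix.of fun a b => if σ a = b then d a else 0).BlockTriangular b := by
    intro i j hij
    have h1 : i ≠ j := by
      rintro rfl
      exact lt_irrefl _ hij
    have h2 : σ i ≠ j := by
      rintro rfl
      simp [b, hσ] at hij
    simp [h1, h2]
  rw [htri.det_fintype, ← Equiv.prod_comp e]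
  refine Finset.prod_congr rfl fun c _ => ?_
  have hp : ∀ a, b (σ a) = e c ↔ b a = e c := fun a => by simp only [b, hσ]
  have : Nonempty {a // b a = e c} := by
    obtain ⟨a, rfl⟩ := Quotient.exists_rep c
    exact ⟨⟨a, rfl⟩⟩
  have key := Matrix.det_one_add_of_transitive_perm (σ.subtypePerm (p := fun a => b a = e c) hp)
    (fun x y => Equiv.Perm.sameCycle_subtypePerm.2
      (Quotient.exact (s := s) (e.injective (x.2.trans y.2.symm)))) (fun a => d a.1)
  have hblock : (1 + Matrix.of fun a b => if σ a = b then d a else 0).toSquareBlock b (e c) =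
      1 +
        Matrix.of fun x y =>
          if σ.subtypePerm (p := fun a => b a = e c) hp x = y then d x.1 else 0 := by
    ext x y
    simp [Matrix.toSquareBlock_def, Matrix.one_apply, Subtype.ext_iff]
  rw [hblock, key]
  congr 1
  exact Fintype.prod_equiv (Equiv.subtypeEquivRight fun a => by simp [b, s]) _ _ (fun _ => rfl)

namespace QuivRel

variable {G : QuivRel}

/-- The relations of a gentle quiver form a partial injection, which extends to a permutation. -/
theorem Gentle.exists_perm (hG : G.Gentle) :
    ∃ σ : Equiv.Perm G.A, ∀ a b, G.rel a b ↔ (∃ c, G.rel a c) ∧ σ a = b := by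
  classical
  obtain ⟨-, hout, hin⟩ := hG
  let f : {a // ∃ c, G.rel a c} → {b // ∃ a, G.rel a b} :=
    fun a => ⟨a.2.choose, a.1, a.2.choose_spec⟩
  have hf : Function.Bijective f := by
    constructor
    · rintro ⟨a, ha⟩ ⟨b, hb⟩ hab
      have h : ha.choose = hb.choose := congrArg Subtype.val hab
      exact Subtype.ext (hin _ _ _ (h ▸ ha.choose_spec) hb.choose_spec)
    · rintro ⟨b, a, hab⟩
      exact ⟨⟨a, b, hab⟩, Subtype.ext (hout a _ _ (Exists.choose_spec _) hab)⟩
  let e := Equiv.ofBijective f hf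
  have he : ∀ a (h : ∃ c, G.rel a c), G.rel a (e.extendSubtype a) := by
    intro a h
    rw [Equiv.extendSubtype_apply_of_mem e a h]
    exact h.choose_spec
  refine ⟨e.extendSubtype, fun a b => ⟨fun h => ⟨⟨b, h⟩, hout a _ _ (he a ⟨b, h⟩) h⟩, ?_⟩⟩
  rintro ⟨h, rfl⟩
  exact he a h

theorem IsZeroCycle.getElem_mod {σ : Equiv.Perm G.A}
    (hσ : ∀ a b, G.rel a b ↔ (∃ c, G.rel a c) ∧ σ a = b)
    {p : List G.A} (hp : G.IsZeroCycle p) (m : ℕ) :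
    p[m % p.length]'(Nat.mod_lt _ (List.length_pos_iff.2 hp.1)) = (σ ^ m) (p.head hp.1) := by
  have hpos := List.length_pos_iff.2 hp.1
  induction m with
  | zero => simp [List.head_eq_getElem]
  | succ m ih =>
    rw [pow_succ', Equiv.Perm.mul_apply, ← ih]
    have h := ((hσ _ _).1 (hp.2 ⟨m % p.length, Nat.mod_lt _ hpos⟩)).2
    simp only [List.get_eq_getElem, Nat.mod_add_mod] at h
    exact h.symm

theorem IsZeroCycle.mem_iff {σ : Equiv.Perm G.A}
    (hσ : ∀ a b, G.rel a b ↔ (∃ c, G.rel a c) ∧ σ a = b)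
    {p : List G.A} (hp : G.IsZeroCycle p) (x : G.A) :
    x ∈ p ↔ σ.SameCycle (p.head hp.1) x := by
  constructor
  · intro h
    obtain ⟨i, hi, rfl⟩ := List.mem_iff_getElem.1 h
    refine ⟨i, ?_⟩
    rw [zpow_natCast, ← hp.getElem_mod hσ]
    simp [Nat.mod_eq_of_lt hi]
  · intro h
    obtain ⟨m, rfl⟩ := h.exists_nat_pow_eq
    rw [← hp.getElem_mod hσ]
    exact List.getElem_mem _

theorem IsZeroCycle.isRotated_iff {σ : Equiv.Perm G.A}
    (hσ : ∀ a b, G.rel a b ↔ (∃ c, G.rel a c) ∧ σ a = b)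
    {p p' : List G.A} (hp : G.IsZeroCycle p)
    (hp' : G.IsZeroCycle p') (hlen : p.length = p'.length) :
    p ~r p' ↔ σ.SameCycle (p.head hp.1) (p'.head hp'.1) := by
  constructor
  · intro h
    rw [← hp.mem_iff hσ, h.mem_iff]
    exact List.head_mem _
  · intro h
    obtain ⟨i, hi⟩ := h.exists_nat_pow_eq
    refine ⟨i, List.ext_getElem (by simp [hlen]) fun j h1 h2 => ?_⟩
    have h3 := hp'.getElem_mod hσ j
    simp only [Nat.mod_eq_of_lt h2] at h3
    rw [List.getElem_rotate, hp.getElem_mod hσ, h3, ← hi, pow_add, Equiv.Perm.mul_apply]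

theorem IsMinZeroCycle.card_orbit {σ : Equiv.Perm G.A}
    (hσ : ∀ a b, G.rel a b ↔ (∃ c, G.rel a c) ∧ σ a = b)
    {p : List G.A} (hp : G.IsMinZeroCycle p) :
    Nat.card {a // Quotient.mk (Equiv.Perm.SameCycle.setoid σ) a = Quotient.mk _ (p.head hp.1.1)} =
      p.length := by
  have h : ∀ a, Quotient.mk (Equiv.Perm.SameCycle.setoid σ) a = Quotient.mk _ (p.head hp.1.1) ↔
      a ∈ p.toFinset := fun a => by
    rw [List.mem_toFinset, hp.1.mem_iff hσ]
    exact ⟨fun h => (Quotient.exact h).symm, fun h => Quotient.sound h.symm⟩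
  rw [Nat.card_congr (Equiv.subtypeEquivRight h), Nat.card_eq_fintype_card, Fintype.card_coe]
  exact List.toFinset_card_of_nodup hp.2

/-- Every orbit of `σ` all of whose arrows start a relation comes from a minimal zero cycle. -/
theorem exists_isMinZeroCycle_head_eq {σ : Equiv.Perm G.A}
    (hσ : ∀ a b, G.rel a b ↔ (∃ c, G.rel a c) ∧ σ a = b)
    (a : G.A)
    (ha : ∀ b, σ.SameCycle a b → ∃ c, G.rel b c) :
    ∃ p, ∃ hp : G.IsMinZeroCycle p, p.head hp.1.1 = a := by
  have hpos : 0 < Function.minimalPeriod σ a :=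
    Function.minimalPeriod_pos_of_mem_periodicPts
      (Function.Injective.mem_periodicPts σ.injective a)
  let p := (List.range (Function.minimalPeriod σ a)).map fun i => σ^[i] a
  have hlen : p.length = Function.minimalPeriod σ a := by simp [p]
  have hne : p ≠ [] := List.length_pos_iff.1 (hlen ▸ hpos)
  refine ⟨p, ⟨⟨hne, fun i => ?_⟩, ?_⟩, ?_⟩
  · rw [hσ]
    simp only [List.get_eq_getElem, p, List.getElem_map, List.getElem_range]
    refine ⟨ha _ ⟨i.1, ?_⟩, ?_⟩
    · rw [zpow_natCast, Equiv.Perm.coe_pow]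
    · simp only [List.length_map, List.length_range, Function.iterate_mod_minimalPeriod_eq,
        Function.iterate_succ_apply']
  · refine List.Nodup.map_on (fun i hi j hj h => ?_) List.nodup_range
    exact Function.iterate_injOn_Iio_minimalPeriod (List.mem_range.1 hi) (List.mem_range.1 hj) h
  · simp [p, List.head_eq_getElem]

theorem numCycles_eq_card_orbits {σ : Equiv.Perm G.A}
    (hσ : ∀ a b, G.rel a b ↔ (∃ c, G.rel a c) ∧ σ a = b)
    (k : ℕ) :
    G.numCycles k = Nat.card {c : Quotient (Equiv.Perm.SameCycle.setoid σ) //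
      (∀ a, Quotient.mk _ a = c → ∃ b, G.rel a b) ∧
        Nat.card {a // Quotient.mk (Equiv.Perm.SameCycle.setoid σ) a = c} = k} := by
  let F : {p : List G.A // G.IsMinZeroCycle p ∧ p.length = k} →
      Quotient (Equiv.Perm.SameCycle.setoid σ) := fun p => Quotient.mk _ (p.1.head p.2.1.1.1)
  have hker : G.cycleSetoid (fun p => G.IsMinZeroCycle p ∧ p.length = k) = Setoid.ker F := by
    ext p p'
    rw [Setoid.ker_def]
    refine Iff.trans ?_ (Quotient.eq (r := Equiv.Perm.SameCycle.setoid σ)).symm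
    exact p.2.1.1.isRotated_iff hσ p'.2.1.1 (p.2.2.trans p'.2.2.symm)
  rw [numCycles, hker, Nat.card_congr (Setoid.quotientKerEquivRange F)]
  refine Nat.card_congr (Equiv.subtypeEquivRight fun c => ⟨?_, ?_⟩)
  · rintro ⟨⟨p, hp, hk⟩, rfl⟩
    refine ⟨fun a ha => ?_, (hp.card_orbit hσ).trans hk⟩
    have hmem : a ∈ p := (hp.1.mem_iff hσ a).2 (Quotient.exact ha).symm
    obtain ⟨i, hi, rfl⟩ := List.mem_iff_getElem.1 hmem
    exact ⟨_, hp.1.2 ⟨i, hi⟩⟩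
  · rintro ⟨hgood, hcard⟩
    obtain ⟨a, rfl⟩ := Quotient.exists_rep c
    obtain ⟨p, hp, rfl⟩ := exists_isMinZeroCycle_head_eq hσ a
      fun b hb => hgood b (Quotient.sound hb.symm)
    exact ⟨⟨p, hp, (hp.card_orbit hσ).symm.trans hcard⟩, rfl⟩

open Classical in
/-- The matrix recording which pairs of arrows are zero relations. -/
noncomputable def relMatrix (G : QuivRel) (R : Type*) [CommRing R] : Matrix G.A G.A R :=
  Matrix.of fun a b => if G.rel a b then 1 else 0

open Polynomial in
theorem Gentle.det_one_add_relMatrix (hG : G.Gentle) :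
    (1 + (X : ℤ[X]) • G.relMatrix ℤ[X]).det =
      ∏ᶠ k : ℕ, (1 - (-X) ^ (k + 1)) ^ G.numCycles (k + 1) := by
  classical
  obtain ⟨σ, hσ⟩ := hG.exists_perm
  let O := Quotient (Equiv.Perm.SameCycle.setoid σ)
  let size : O → ℕ := fun c => Nat.card {a // Quotient.mk (Equiv.Perm.SameCycle.setoid σ) a = c}
  let good : O → Prop := fun c => ∀ a, Quotient.mk _ a = c → ∃ b, G.rel a b
  have hmat : (X : ℤ[X]) • G.relMatrix ℤ[X] =
      Matrix.of fun a b => if σ a = b then (if ∃ c, G.rel a c then X else 0) else 0 := by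
    ext1 a b
    by_cases h1 : σ a = b <;> by_cases h2 : ∃ c, G.rel a c <;>
      simp only [relMatrix, Matrix.smul_apply, Matrix.of_apply, hσ a b, h1, h2] <;> simp
  have hterm : ∀ c : O, (1 - ∏ a : {a // Quotient.mk (Equiv.Perm.SameCycle.setoid σ) a = c},
      -(if ∃ b, G.rel a.1 b then (X : ℤ[X]) else 0)) =
      if good c then 1 - (-X) ^ size c else 1 := by
    intro c
    split_ifs with hc
    · rw [Finset.prod_congr rfl (g := fun _ => -X) fun a _ => by rw [if_pos (hc a.1 a.2)]]
      simp [size, Nat.card_eq_fintype_card]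
    · obtain ⟨a, ha, hb⟩ : ∃ a, Quotient.mk _ a = c ∧ ¬ ∃ b, G.rel a b := by
        simpa [good] using hc
      rw [Finset.prod_eq_zero (Finset.mem_univ ⟨a, ha⟩) (by rw [if_neg hb, neg_zero]), sub_zero]
  have hnum : ∀ k, G.numCycles k =
      ((Finset.univ.filter good).filter fun c => size c = k).card := by
    intro k
    rw [numCycles_eq_card_orbits hσ, Nat.card_eq_fintype_card, Fintype.card_subtype,
      Finset.filter_filter]
  have hpos : ∀ c, 0 < size c := by
    intro c
    obtain ⟨a, rfl⟩ := Quotient.exists_rep c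
    exact Nat.card_pos_iff.2 ⟨⟨⟨a, rfl⟩⟩, inferInstance⟩
  have hle : ∀ c, size c ≤ Fintype.card G.A := fun c => by
    rw [← Nat.card_eq_fintype_card]
    exact Nat.card_le_card_of_injective _ Subtype.val_injective
  rw [hmat, Matrix.det_one_add_perm, Finset.prod_congr rfl fun c _ => hterm c,
    ← Finset.prod_filter]
  rw [finprod_eq_prod_of_mulSupport_subset (s := Finset.range (Fintype.card G.A))]
  · rw [← Finset.prod_fiberwise_of_maps_to (g := fun c => size c - 1)
      (t := Finset.range (Fintype.card G.A))]
    · refine Finset.prod_congr rfl fun k _ => ?_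
      rw [hnum, ← Finset.prod_const]
      refine Finset.prod_congr (Finset.filter_congr fun c _ => ?_) fun c hc => ?_
      · have := hpos c
        omega
      · rw [(Finset.mem_filter.1 hc).2]
    · intro c _
      have := hpos c
      have := hle c
      rw [Finset.mem_range]
      omega
  · intro k hk
    by_contra hk'
    refine hk ?_
    have : G.numCycles (k + 1) = 0 := by
      rw [hnum, Finset.card_eq_zero, Finset.filter_eq_empty_iff]
      intro c _ hc
      have := hle c
      simp at hk'
      omega
    simp [this]

open Classical in
/-- The matrix recording which pairs of composable arrows are nonzero paths. -/
noncomputable def stepMatrix (G : QuivRel) (R : Type*) [CommRing R] : Matrix G.A G.A R :=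
  Matrix.of fun a b => if G.tgt a = G.src b ∧ ¬ G.rel a b then 1 else 0

/-- The incidence matrix of start vertices. -/
def srcMatrix (G : QuivRel) (R : Type*) [CommRing R] : Matrix G.V G.A R :=
  Matrix.of fun v a => if G.src a = v then 1 else 0

/-- The incidence matrix of end vertices. -/
def tgtMatrix (G : QuivRel) (R : Type*) [CommRing R] : Matrix G.A G.V R :=
  Matrix.of fun a v => if G.tgt a = v then 1 else 0

theorem tgtMatrix_mul_srcMatrix (R : Type*) [CommRing R] :
    G.tgtMatrix R * G.srcMatrix R = G.stepMatrix R + G.relMatrix R := by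
  classical
  ext a b
  have := G.rel_comp a b
  by_cases h : G.rel a b <;> by_cases h' : G.tgt a = G.src b <;>
    simp_all [Matrix.mul_apply, tgtMatrix, srcMatrix, stepMatrix, relMatrix, eq_comm]

theorem exists_path_of_stepMatrix_pow_ne_zero (R : Type*) [CommRing R] (n : ℕ) (a b : G.A)
    (h : (G.stepMatrix R ^ n) a b ≠ 0) :
    ∃ p : List G.A, p.length = n ∧ G.IsNonzeroPath (a :: p) := by
  induction n generalizing a with
  | zero => exact ⟨[], rfl, List.isChain_singleton _⟩
  | succ n ih =>
    rw [pow_succ', Matrix.mul_apply] at h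
    obtain ⟨c, -, hc⟩ := Finset.exists_ne_zero_of_sum_ne_zero h
    obtain ⟨p, hp, hchain⟩ := ih c (right_ne_zero_of_mul hc)
    have h1 : G.tgt a = G.src c ∧ ¬ G.rel a c := by
      by_contra h1
      exact left_ne_zero_of_mul hc (by simp only [stepMatrix, Matrix.of_apply, if_neg h1])
    exact ⟨c :: p, by simp [hp], List.isChain_cons_cons.2 ⟨h1, hchain⟩⟩

theorem FinDim.exists_stepMatrix_pow_eq_zero (hfd : G.FinDim) (R : Type*) [CommRing R] :
    ∃ N, ∀ n, N ≤ n → G.stepMatrix R ^ n = 0 := by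
  obtain ⟨N, hN⟩ := hfd
  refine ⟨N, fun n hn => ?_⟩
  ext a b
  by_contra h
  obtain ⟨p, hp, hchain⟩ := exists_path_of_stepMatrix_pow_ne_zero R n a b h
  have := hN _ hchain
  simp only [List.length_cons] at this
  omega

/-- Nonzero paths of length `n + 1` with first arrow `a` and end vertex `j`. -/
theorem card_paths_cons (R : Type*) [CommRing R] (n : ℕ) (a : G.A) (j : G.V) :
    (Nat.card {p : List G.A // p.length = n ∧ G.IsNonzeroPath (a :: p) ∧
      G.tgt ((a :: p).getLast (List.cons_ne_nil _ _)) = j} : R) =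
      (G.stepMatrix R ^ n * G.tgtMatrix R) a j := by
  classical
  induction n generalizing a with
  | zero =>
    rw [pow_zero, Matrix.one_mul]
    by_cases h : G.tgt a = j
    · have : Unique {p : List G.A // p.length = 0 ∧ G.IsNonzeroPath (a :: p) ∧
          G.tgt ((a :: p).getLast (List.cons_ne_nil _ _)) = j} :=
        ⟨⟨⟨[], rfl, List.isChain_singleton _, h⟩⟩, fun p =>
          Subtype.ext (List.length_eq_zero_iff.1 p.2.1)⟩
      rw [Nat.card_unique]
      simp [tgtMatrix, h]
    · have : IsEmpty {p : List G.A // p.length = 0 ∧ G.IsNonzeroPath (a :: p) ∧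
          G.tgt ((a :: p).getLast (List.cons_ne_nil _ _)) = j} := by
        refine ⟨fun ⟨p, hp, _, hj⟩ => ?_⟩
        obtain rfl := List.length_eq_zero_iff.1 hp
        exact h hj
      rw [Nat.card_of_isEmpty]
      simp [tgtMatrix, h]
  | succ n ih =>
    have hfin : ∀ b, Finite {p : List G.A // p.length = n ∧ G.IsNonzeroPath (b :: p) ∧
        G.tgt ((b :: p).getLast (List.cons_ne_nil _ _)) = j} := fun b =>
      ((List.finite_length_eq G.A n).subset fun p hp => hp.1).to_subtype
    let e : {p : List G.A // p.length = n + 1 ∧ G.IsNonzeroPath (a :: p) ∧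
        G.tgt ((a :: p).getLast (List.cons_ne_nil _ _)) = j} ≃
        Σ b : {b // G.tgt a = G.src b ∧ ¬ G.rel a b},
          {p : List G.A // p.length = n ∧ G.IsNonzeroPath (b.1 :: p) ∧
            G.tgt ((b.1 :: p).getLast (List.cons_ne_nil _ _)) = j} :=
      { toFun := fun
          | ⟨[], h⟩ => absurd h.1 (by simp)
          | ⟨b :: p, h⟩ => ⟨⟨b, (List.isChain_cons_cons.1 h.2.1).1⟩, p, by simpa using h.1,
              (List.isChain_cons_cons.1 h.2.1).2, by simpa using h.2.2⟩
        invFun := fun ⟨b, p, h⟩ => ⟨b.1 :: p, by simpa using h.1,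
          List.isChain_cons_cons.2 ⟨b.2, h.2.1⟩, by simpa using h.2.2⟩
        left_inv := fun
          | ⟨[], h⟩ => absurd h.1 (by simp)
          | ⟨b :: p, h⟩ => rfl
        right_inv := fun _ => rfl }
    rw [Nat.card_congr e, Nat.card_sigma, Nat.cast_sum, pow_succ', Matrix.mul_assoc,
      Matrix.mul_apply]
    simp_rw [ih]
    simp only [stepMatrix, Matrix.of_apply, ite_mul, one_mul, zero_mul]
    rw [← Finset.sum_filter]
    symm
    apply Finset.sum_subtype
    simp

theorem card_paths_succ (R : Type*) [CommRing R] (n : ℕ) (i j : G.V) :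
    (Nat.card {p : List G.A // p.length = n + 1 ∧ G.IsNonzeroPathFrom i j p} : R) =
      (G.srcMatrix R * (G.stepMatrix R ^ n * G.tgtMatrix R)) i j := by
  classical
  have hfin : ∀ b, Finite {p : List G.A // p.length = n ∧ G.IsNonzeroPath (b :: p) ∧
      G.tgt ((b :: p).getLast (List.cons_ne_nil _ _)) = j} := fun b =>
    ((List.finite_length_eq G.A n).subset fun p hp => hp.1).to_subtype
  let e : {p : List G.A // p.length = n + 1 ∧ G.IsNonzeroPathFrom i j p} ≃
      Σ b : {b // G.src b = i},
        {p : List G.A // p.length = n ∧ G.IsNonzeroPath (b.1 :: p) ∧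
          G.tgt ((b.1 :: p).getLast (List.cons_ne_nil _ _)) = j} :=
    { toFun := fun
        | ⟨[], h⟩ => absurd h.1 (by simp)
        | ⟨b :: p, h⟩ => ⟨⟨b, h.2.2.1 b rfl⟩, p, by simpa using h.1, h.2.1,
            h.2.2.2.1 _ (List.getLast?_eq_some_getLast _)⟩
      invFun := fun ⟨b, p, h⟩ => ⟨b.1 :: p, by simpa using h.1, h.2.1, by simpa using b.2,
        fun c hc => by
          rw [List.getLast?_eq_some_getLast (List.cons_ne_nil _ _), Option.mem_some_iff] at hc
          exact hc ▸ h.2.2, by simp⟩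
      left_inv := fun
        | ⟨[], h⟩ => absurd h.1 (by simp)
        | ⟨b :: p, h⟩ => rfl
      right_inv := fun _ => rfl }
  rw [Nat.card_congr e, Nat.card_sigma, Nat.cast_sum, Matrix.mul_apply]
  simp_rw [card_paths_cons]
  simp only [srcMatrix, Matrix.of_apply, ite_mul, one_mul, zero_mul]
  rw [← Finset.sum_filter]
  symm
  apply Finset.sum_subtype
  simp

theorem card_paths_zero (R : Type*) [CommRing R] (i j : G.V) :
    (Nat.card {p : List G.A // p.length = 0 ∧ G.IsNonzeroPathFrom i j p} : R) =
      (1 : Matrix G.V G.V R) i j := by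
  by_cases h : i = j
  · have : Unique {p : List G.A // p.length = 0 ∧ G.IsNonzeroPathFrom i j p} :=
      ⟨⟨⟨[], rfl, List.isChain_nil, by simp, by simp, fun _ => h⟩⟩, fun p =>
        Subtype.ext (List.length_eq_zero_iff.1 p.2.1)⟩
    simp only [Nat.card_unique, Matrix.one_apply, if_pos h, Nat.cast_one]
  · have : IsEmpty {p : List G.A // p.length = 0 ∧ G.IsNonzeroPathFrom i j p} :=
      ⟨fun ⟨p, hp, hij⟩ => h (hij.2.2.2 (List.length_eq_zero_iff.1 hp))⟩
    simp only [Nat.card_of_isEmpty, Matrix.one_apply, if_neg h, Nat.cast_zero]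

open Polynomial in
theorem qCartan_eq_of_stepMatrix_pow_eq_zero {N : ℕ}
    (hN : ∀ n, N ≤ n → G.stepMatrix ℤ[X] ^ n = 0) :
    G.qCartan = 1 + G.srcMatrix ℤ[X] *
      ((X : ℤ[X]) • ((∑ n ∈ Finset.range N, ((X : ℤ[X]) • G.stepMatrix ℤ[X]) ^ n) *
        G.tgtMatrix ℤ[X])) := by
  ext1 i j
  rw [qCartan, finsum_eq_sum_of_support_subset (s := Finset.range (N + 1))]
  · rw [Finset.sum_range_succ', card_paths_zero]
    simp_rw [card_paths_succ]
    simp only [Matrix.sum_mul, Finset.smul_sum, Matrix.mul_sum, Matrix.add_apply, Matrix.sum_apply,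
      _root_.smul_pow, Matrix.smul_mul, Matrix.mul_smul, Matrix.smul_apply, smul_eq_mul]
    rw [add_comm, pow_zero, mul_one]
    congr 1
    exact Finset.sum_congr rfl fun n _ => by ring
  · intro n hn
    by_contra hn'
    refine hn ?_
    obtain ⟨m, rfl⟩ : ∃ m, n = m + 1 := ⟨n - 1, by simp at hn'; omega⟩
    have hm : N ≤ m := by simpa using hn'
    simp [card_paths_succ, hN m hm]

open Polynomial in
theorem FinDim.det_one_sub_stepMatrix (hfd : G.FinDim) :
    (1 - (X : ℤ[X]) • G.stepMatrix ℤ[X]).det = 1 := by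
  obtain ⟨N, hN⟩ := hfd.exists_stepMatrix_pow_eq_zero ℤ
  have hmap : (G.stepMatrix ℤ).map C = G.stepMatrix ℤ[X] := by
    ext1 a b
    simp [stepMatrix, apply_ite (C : ℤ → ℤ[X])]
  have h : (G.stepMatrix ℤ).charpolyRev = (1 - (X : ℤ[X]) • G.stepMatrix ℤ[X]).det := by
    rw [Matrix.charpolyRev, hmap]
  rw [← h]
  obtain ⟨r, -, hr⟩ := Polynomial.isUnit_iff.1
    (Matrix.isUnit_charpolyRev_of_isNilpotent ⟨N, hN N le_rfl⟩)
  have h0 := Matrix.eval_charpolyRev (M := G.stepMatrix ℤ)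
  rw [← hr, eval_C] at h0
  rw [← hr, h0, C_1]

open Polynomial in
theorem FinDim.det_qCartan (hfd : G.FinDim) :
    G.qCartan.det = (1 + (X : ℤ[X]) • G.relMatrix ℤ[X]).det := by
  obtain ⟨N, hN⟩ := hfd.exists_stepMatrix_pow_eq_zero ℤ[X]
  rw [qCartan_eq_of_stepMatrix_pow_eq_zero hN, Matrix.det_one_add_mul_comm]
  have hinv : (1 - (X : ℤ[X]) • G.stepMatrix ℤ[X]) *
      ∑ n ∈ Finset.range N, ((X : ℤ[X]) • G.stepMatrix ℤ[X]) ^ n = 1 := by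
    rw [mul_neg_geom_sum, _root_.smul_pow, hN N le_rfl, smul_zero, sub_zero]
  rw [← one_mul (Matrix.det _), ← hfd.det_one_sub_stepMatrix, ← Matrix.det_mul, mul_add, mul_one,
    Matrix.smul_mul, Matrix.mul_smul, Matrix.mul_assoc (Finset.sum _ _), ← Matrix.mul_assoc, hinv,
    Matrix.one_mul, tgtMatrix_mul_srcMatrix, smul_add]
  congr 1
  abel

end QuivRel

/-- **Corollary 1.** Let `(Q,I)` be a gentle quiver and `A = KQ/I` the
corresponding (finite-dimensional) gentle algebra, and let `c_k` be the number
of minimal oriented `k`-cycles in `Q` with full zero relations.  Then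
`det C_A(q) = ∏_{k ≥ 1} (1 - (-q)^k)^{c_k}`. -/
theorem qCartan_det (G : QuivRel) (hG : G.Gentle) (hfd : G.FinDim) :
    G.qCartan.det =
      ∏ᶠ k : ℕ, (1 - (- Polynomial.X) ^ (k + 1)) ^ G.numCycles (k + 1) := by
  rw [hfd.det_qCartan, hG.det_one_add_relMatrix]
end

section
/- Let (Q,I) be a gentle quiver, K a field, and A = KQ/I the corresponding gentle algebra. Then the determinant of the ordinary Cartan matrix C_A equals 0 if ec(Q,I) > 0, and equals 2^{oc(Q,I)} otherwise. -/
open Matrix Relation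

/-- The elements from which `a` can be reached along `r`. -/
noncomputable def predSet {n : Type} [Fintype n] (r : n → n → Prop) (a : n) : Finset n :=
  open Classical in Finset.univ.filter fun c => ReflTransGen r c a

section
variable {n : Type} [Fintype n] {r : n → n → Prop}

theorem mem_predSet {a c : n} : c ∈ predSet r a ↔ ReflTransGen r c a := by
  simp [predSet]

theorem predSet_subset {a b : n} (h : ReflTransGen r a b) : predSet r a ⊆ predSet r b :=
  fun _ hc => mem_predSet.2 ((mem_predSet.1 hc).trans h)

theorem predSet_eq_iff {a b : n} :
    predSet r a = predSet r b ↔ ReflTransGen r a b ∧ ReflTransGen r b a := by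
  refine ⟨fun h => ⟨?_, ?_⟩, fun h => (predSet_subset h.1).antisymm (predSet_subset h.2)⟩
  · rw [← mem_predSet, ← h, mem_predSet]
  · rw [← mem_predSet, h, mem_predSet]

variable [DecidableEq n]

/-- A matrix supported on the diagonal and on a relation has as determinant the product of the
determinants of the blocks of strongly connected components. -/
theorem det_eq_prod_predSet {M : Matrix n n ℤ} (h : ∀ i j, M i j ≠ 0 → i = j ∨ r i j) :
    M.det = ∏ S ∈ Finset.univ.image (predSet r), (M.toSquareBlock (predSet r) S).det := by
  have hM : M.BlockTriangular (fun i => toLinearExtension (predSet r i)) := by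
    intro i j hij
    by_contra hne
    have hle : predSet r i ≤ predSet r j := by
      rcases h i j hne with rfl | hr
      · exact le_rfl
      · exact predSet_subset (ReflTransGen.single hr)
    exact absurd (toLinearExtension.monotone hle) (not_le_of_gt hij)
  have hinj : Function.Injective (toLinearExtension : Finset n → LinearExtension (Finset n)) :=
    fun _ _ h => h
  have himg : Finset.univ.image (fun i => toLinearExtension (predSet r i)) =
      (Finset.univ.image (predSet r)).image toLinearExtension := by
    rw [Finset.image_image]
    rfl
  rw [hM.det, himg, Finset.prod_image hinj.injOn]
  refine Finset.prod_congr rfl fun S _ => ?_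
  exact Matrix.det_submatrix_equiv_self (Equiv.subtypeEquivRight fun i => hinj.eq_iff)
    (M.toSquareBlock (predSet r) S)

omit [DecidableEq n] in
theorem eq_of_predSet_eq {a b : n} (ha : ¬ TransGen r a a) (h : predSet r b = predSet r a) :
    b = a := by
  obtain ⟨h1, h2⟩ := predSet_eq_iff.1 h
  rcases h2.cases_head with h | ⟨c, hc, hcb⟩
  · exact h.symm
  · exact absurd (TransGen.head' hc (hcb.trans h1)) ha

theorem det_toSquareBlock_of_not_cyclic (M : Matrix n n ℤ) {a : n} (ha : ¬ TransGen r a a) :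
    (M.toSquareBlock (predSet r) (predSet r a)).det = M a a := by
  let _ : Unique {i // predSet r i = predSet r a} :=
    { default := ⟨a, rfl⟩
      uniq := fun b => Subtype.ext (eq_of_predSet_eq ha b.2) }
  rw [Matrix.det_unique]
  rfl

theorem det_eq_one_of_acyclic {M : Matrix n n ℤ} (h : ∀ i j, M i j ≠ 0 → i = j ∨ r i j)
    (hr : ∀ a, ¬ TransGen r a a) (hd : ∀ a, M a a = 1) : M.det = 1 := by
  rw [det_eq_prod_predSet h]
  refine Finset.prod_eq_one fun S hS => ?_
  obtain ⟨a, -, rfl⟩ := Finset.mem_image.1 hS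
  rw [det_toSquareBlock_of_not_cyclic M (hr a), hd]

end

theorem sign_of_transitive {n : Type} [Fintype n] [DecidableEq n] [Nontrivial n]
    (τ : Equiv.Perm n) (hτ : ∀ x y, ∃ k : ℕ, (τ ^ k) x = y) :
    Equiv.Perm.sign τ = -(-1) ^ Fintype.card n ∧ ∀ x, τ x ≠ x := by
  have hfix : ∀ x, τ x ≠ x := by
    intro x hx
    obtain ⟨y, hy⟩ := exists_ne x
    obtain ⟨k, hk⟩ := hτ x y
    rw [Equiv.Perm.pow_apply_eq_self_of_apply_eq_self hx] at hk
    exact hy hk.symm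
  have hc : τ.IsCycle := by
    obtain ⟨x⟩ := (inferInstance : Nonempty n)
    refine ⟨x, hfix x, fun y _ => ?_⟩
    obtain ⟨k, hk⟩ := hτ x y
    exact ⟨k, by simpa using hk⟩
  have hs : τ.support = Finset.univ := by
    ext x; simp [hfix x]
  exact ⟨by rw [hc.sign, hs, Finset.card_univ], hfix⟩

theorem det_one_add_transitive {n : Type} [Fintype n] [DecidableEq n] [Nonempty n]
    (τ : Equiv.Perm n) (hτ : ∀ x y, ∃ k : ℕ, (τ ^ k) x = y) {M : Matrix n n ℤ}
    (hM : ∀ i j, M i j = (if i = j then 1 else 0) + (if τ i = j then 1 else 0)) :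
    M.det = if Even (Fintype.card n) then 0 else 2 := by
  rcases subsingleton_or_nontrivial n with hn | hn
  · obtain ⟨x⟩ := (inferInstance : Nonempty n)
    have : Unique n := uniqueOfSubsingleton x
    rw [Matrix.det_unique, Fintype.card_unique, hM]
    simp [Subsingleton.elim (τ default) default]
  · obtain ⟨hsign, hfix⟩ := sign_of_transitive τ hτ
    have h1 : (1 : Equiv.Perm n) ≠ τ := fun h => by
      obtain ⟨x⟩ := (inferInstance : Nonempty n)
      exact hfix x (by rw [← h]; rfl)
    rw [← Matrix.det_transpose, Matrix.det_apply,
      ← Finset.sum_subset (Finset.subset_univ {1, τ}), Finset.sum_pair h1, hsign]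
    · have e1 : ∏ i, Mᵀ ((1 : Equiv.Perm n) i) i = 1 :=
        Finset.prod_eq_one fun i _ => by simp [hM, hfix]
      have e2 : ∏ i, Mᵀ (τ i) i = 1 :=
        Finset.prod_eq_one fun i _ => by simp [hM, (hfix i).symm]
      rw [e1, e2]
      rcases Nat.even_or_odd (Fintype.card n) with h | h
      · simp [h.neg_one_pow, h]
      · simp [h.neg_one_pow, Nat.not_even_iff_odd.2 h]
    · intro ρ _ hρ
      simp only [Finset.mem_insert, Finset.mem_singleton, not_or] at hρ
      by_contra hne
      have hne' : ∀ i, ρ i = i ∨ ρ i = τ i := by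
        intro i
        by_contra hi
        rw [not_or] at hi
        refine hne ?_
        rw [Finset.prod_eq_zero (Finset.mem_univ i), smul_zero]
        simp [hM, Ne.symm hi.1, Ne.symm hi.2]
      obtain ⟨x, hx⟩ : ∃ x, ρ x ≠ x := by
        by_contra! h
        exact hρ.1 (Equiv.ext h)
      have key : ∀ k : ℕ, ρ ((τ ^ k) x) ≠ (τ ^ k) x := by
        intro k
        induction k with
        | zero => simpa using hx
        | succ k ih =>
          rw [pow_succ', Equiv.Perm.mul_apply]
          intro h
          rw [← (hne' _).resolve_left ih] at h
          exact ih (ρ.injective h)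
      refine hρ.2 (Equiv.ext fun y => ?_)
      obtain ⟨k, rfl⟩ := hτ x y
      exact (hne' _).resolve_left (key k)

section
variable {n : Type} [Fintype n] [DecidableEq n] {r : n → n → Prop}

omit [DecidableEq n] in
theorem exists_rel_of_cyclic {a : n} (ha : TransGen r a a) :
    ∃ b, r a b ∧ predSet r b = predSet r a := by
  obtain ⟨b, hab, hba⟩ := (TransGen.head'_iff).1 ha
  exact ⟨b, hab, predSet_eq_iff.2 ⟨hba, ReflTransGen.single hab⟩⟩

omit [DecidableEq n] in
theorem cyclic_of_predSet_eq {a b : n} (ha : TransGen r a a) (h : predSet r b = predSet r a) :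
    TransGen r b b := by
  obtain ⟨h1, h2⟩ := predSet_eq_iff.1 h
  exact (TransGen.trans_right h1 ha).trans_left h2

theorem det_toSquareBlock_of_cyclic (hf : ∀ a b c, r a b → r a c → b = c)
    (hi : ∀ a b c, r b a → r c a → b = c) {M : Matrix n n ℤ} [DecidableRel r]
    (hM : ∀ i j, M i j = (if i = j then 1 else 0) + (if r i j then 1 else 0))
    {a : n} (ha : TransGen r a a) :
    (M.toSquareBlock (predSet r) (predSet r a)).det =
      if Even (Fintype.card {i // predSet r i = predSet r a}) then 0 else 2 := by
  have hs : ∀ x : {i // predSet r i = predSet r a},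
      ∃ y : {i // predSet r i = predSet r a}, r x y := by
    rintro ⟨x, hx⟩
    obtain ⟨y, hxy, hy⟩ := exists_rel_of_cyclic (cyclic_of_predSet_eq ha hx)
    exact ⟨⟨y, hy.trans hx⟩, hxy⟩
  choose f hf' using hs
  have hinj : Function.Injective f := fun x y hxy =>
    Subtype.ext (hi _ _ _ (hf' x) (hxy ▸ hf' y))
  let τ : Equiv.Perm {i // predSet r i = predSet r a} :=
    Equiv.ofBijective f (Finite.injective_iff_bijective.1 hinj)
  have : Nonempty {i // predSet r i = predSet r a} := ⟨⟨a, rfl⟩⟩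
  refine det_one_add_transitive τ ?_ ?_
  · rintro x ⟨y, hy⟩
    have hxy : ReflTransGen r x.1 y := (predSet_eq_iff.1 (x.2.trans hy.symm)).1
    suffices H : ∀ z, ReflTransGen r x.1 z → ∃ k : ℕ, ((τ ^ k) x).1 = z by
      obtain ⟨k, hk⟩ := H y hxy
      exact ⟨k, Subtype.ext hk⟩
    intro z hz
    induction hz with
    | refl => exact ⟨0, rfl⟩
    | tail _ hbc ih =>
      obtain ⟨k, rfl⟩ := ih
      refine ⟨k + 1, ?_⟩
      rw [pow_succ', Equiv.Perm.mul_apply]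
      exact hf _ _ _ (hf' _) hbc
  · intro i j
    have e : τ i = j ↔ r i j :=
      ⟨fun h => h ▸ hf' i, fun h => Subtype.ext (hf _ _ _ (hf' i) h)⟩
    simp [Matrix.toSquareBlock_def, hM, e, Subtype.ext_iff]

omit [DecidableEq n] in
theorem reflTransGen_of_mem_predSet (hi : ∀ a b c, r b a → r c a → b = c) {a c : n}
    (ha : TransGen r a a) (hc : ReflTransGen r c a) : ReflTransGen r a c := by
  induction hc using ReflTransGen.head_induction_on with
  | refl => exact .refl
  | head hcd hda ih =>
    have hd := cyclic_of_predSet_eq ha (predSet_eq_iff.2 ⟨hda, ih⟩)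
    obtain ⟨e, hde, hed⟩ := TransGen.tail'_iff.1 hd
    exact hi _ _ _ hcd hed ▸ ih.trans hde

theorem card_fiber_predSet (hi : ∀ a b c, r b a → r c a → b = c) {a : n}
    (ha : TransGen r a a) :
    Fintype.card {i // predSet r i = predSet r a} = (predSet r a).card := by
  refine Fintype.card_of_subtype _ fun x => ?_
  rw [mem_predSet, predSet_eq_iff]
  exact ⟨fun h => ⟨h, reflTransGen_of_mem_predSet hi ha h⟩, fun h => h.1⟩

open Classical in
theorem det_one_add_rel (hf : ∀ a b c, r a b → r a c → b = c)
    (hi : ∀ a b c, r b a → r c a → b = c) {M : Matrix n n ℤ}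
    (hM : ∀ i j, M i j = (if i = j then 1 else 0) + (if r i j then 1 else 0)) :
    M.det = ∏ S : Finset n, if ∃ a, TransGen r a a ∧ predSet r a = S then
      (if Even S.card then 0 else 2) else 1 := by
  have hM' : ∀ i j, M i j ≠ 0 → i = j ∨ r i j := by
    intro i j hij
    by_contra! h
    simp [hM, h.1, h.2] at hij
  rw [det_eq_prod_predSet hM']
  rw [← Finset.prod_subset (Finset.subset_univ (Finset.univ.image (predSet r)))]
  · refine Finset.prod_congr rfl fun S hS => ?_
    obtain ⟨a, -, rfl⟩ := Finset.mem_image.1 hS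
    by_cases ha : TransGen r a a
    · rw [if_pos ⟨a, ha, rfl⟩, det_toSquareBlock_of_cyclic hf hi hM ha,
        card_fiber_predSet hi ha]
    · rw [if_neg, det_toSquareBlock_of_not_cyclic M ha, hM]
      · simp [show ¬ r a a from fun h => ha (TransGen.single h)]
      · rintro ⟨b, hb, hba⟩
        exact ha (cyclic_of_predSet_eq hb hba.symm)
  · intro S _ hS
    refine if_neg ?_
    rintro ⟨a, -, rfl⟩
    exact hS (Finset.mem_image_of_mem _ (Finset.mem_univ a))

end

namespace QuivRel

variable {G : QuivRel}

theorem IsZeroCycle.rel_getElem {p : List G.A} (hp : G.IsZeroCycle p) {i : ℕ}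
    (hi : i < p.length) :
    G.rel p[i] (p[(i + 1) % p.length]'(Nat.mod_lt _ (by omega))) :=
  hp.2 ⟨i, hi⟩

theorem IsZeroCycle.length_pos {p : List G.A} (hp : G.IsZeroCycle p) : 0 < p.length :=
  List.length_pos_iff.2 hp.1

theorem IsZeroCycle.reflTransGen_getElem {p : List G.A} (hp : G.IsZeroCycle p) {i : ℕ}
    (hi : i < p.length) (k : ℕ) :
    ReflTransGen G.rel p[i] (p[(i + k) % p.length]'(Nat.mod_lt _ hp.length_pos)) := by
  induction k with
  | zero => simp [Nat.mod_eq_of_lt hi, ReflTransGen.refl]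
  | succ k ih =>
    refine ih.tail ?_
    have h := hp.rel_getElem (Nat.mod_lt (i + k) hp.length_pos)
    simpa only [Nat.mod_add_mod, add_assoc] using h

theorem IsZeroCycle.transGen {p : List G.A} (hp : G.IsZeroCycle p) {a : G.A} (ha : a ∈ p) :
    TransGen G.rel a a := by
  obtain ⟨i, hi, rfl⟩ := List.getElem_of_mem ha
  refine TransGen.head' (hp.rel_getElem hi) ?_
  have h := hp.reflTransGen_getElem (Nat.mod_lt (i + 1) hp.length_pos) (p.length - 1)
  have e : ((i + 1) % p.length + (p.length - 1)) % p.length = i := by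
    have := hp.length_pos
    rw [Nat.mod_add_mod, show i + 1 + (p.length - 1) = i + p.length by omega,
      Nat.add_mod_right, Nat.mod_eq_of_lt hi]
  simpa only [e] using h

theorem IsZeroCycle.predSet_eq (hG : G.Gentle) {p : List G.A} (hp : G.IsZeroCycle p) {a : G.A}
    (ha : a ∈ p) : predSet G.rel a = p.toFinset := by
  ext c
  rw [mem_predSet, List.mem_toFinset]
  constructor
  · intro h
    induction h using ReflTransGen.head_induction_on with
    | refl => exact ha
    | head hcd _ ih =>
      obtain ⟨i, hi, rfl⟩ := List.getElem_of_mem ih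
      have h := hp.rel_getElem (Nat.mod_lt (i + (p.length - 1)) hp.length_pos)
      have e : ((i + (p.length - 1)) % p.length + 1) % p.length = i := by
        have := hp.length_pos
        rw [Nat.mod_add_mod, show i + (p.length - 1) + 1 = i + p.length by omega,
          Nat.add_mod_right, Nat.mod_eq_of_lt hi]
      simp only [e] at h
      rw [hG.2.2 _ _ _ hcd h]
      exact List.getElem_mem _
  · intro hc
    obtain ⟨i, hi, rfl⟩ := List.getElem_of_mem hc
    obtain ⟨j, hj, rfl⟩ := List.getElem_of_mem ha
    have h := hp.reflTransGen_getElem hi (p.length - i + j)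
    have e : (i + (p.length - i + j)) % p.length = j := by
      rw [show i + (p.length - i + j) = j + p.length by omega,
        Nat.add_mod_right, Nat.mod_eq_of_lt hj]
    simpa only [e] using h

theorem IsZeroCycle.isRotated (hG : G.Gentle) {p q : List G.A} (hp : G.IsZeroCycle p)
    (hq : G.IsZeroCycle q) (hl : p.length = q.length) (h : p[0]'hp.length_pos ∈ q) :
    p ~r q := by
  obtain ⟨j, hj, hpq⟩ := List.getElem_of_mem h
  have key : ∀ k, p[k % p.length]'(Nat.mod_lt _ hp.length_pos) =
      q[(k + j) % q.length]'(Nat.mod_lt _ hq.length_pos) := by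
    intro k
    induction k with
    | zero => simp [Nat.mod_eq_of_lt hj, hpq]
    | succ k ih =>
      have h1 := hp.rel_getElem (Nat.mod_lt k hp.length_pos)
      have h2 := hq.rel_getElem (Nat.mod_lt (k + j) hq.length_pos)
      rw [ih] at h1
      have := hG.2.1 _ _ _ h1 h2
      simpa only [Nat.mod_add_mod, add_right_comm] using this
  refine List.IsRotated.symm ⟨j, ?_⟩
  refine List.ext_getElem (by simp [hl]) fun k h1 h2 => ?_
  rw [List.getElem_rotate, ← key k]
  simp only [Nat.mod_eq_of_lt h2]

theorem exists_isMinZeroCycle (hG : G.Gentle) {a : G.A} (ha : TransGen G.rel a a) :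
    ∃ p, G.IsMinZeroCycle p ∧ a ∈ p := by
  have hs : ∀ x, ∃ y, TransGen G.rel x x → G.rel x y ∧ TransGen G.rel y y := by
    intro x
    by_cases hx : TransGen G.rel x x
    · obtain ⟨y, hxy, hy⟩ := exists_rel_of_cyclic hx
      exact ⟨y, fun _ => ⟨hxy, cyclic_of_predSet_eq hx hy⟩⟩
    · exact ⟨x, fun h => absurd h hx⟩
  choose g hg using hs
  have hc : ∀ k, TransGen G.rel (g^[k] a) (g^[k] a) := by
    intro k
    induction k with
    | zero => exact ha
    | succ k ih =>
      rw [Function.iterate_succ_apply']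
      exact (hg _ ih).2
  have hrel : ∀ k, G.rel (g^[k] a) (g^[k + 1] a) := by
    intro k
    rw [Function.iterate_succ_apply']
    exact (hg _ (hc k)).1
  have hper : ∀ c, TransGen G.rel a c → ∃ k, 0 < k ∧ g^[k] a = c := by
    intro c hac
    induction hac with
    | single h => exact ⟨1, one_pos, hG.2.1 _ _ _ (hrel 0) h⟩
    | tail _ h ih =>
      obtain ⟨k, -, rfl⟩ := ih
      exact ⟨k + 1, k.succ_pos, hG.2.1 _ _ _ (hrel k) h⟩
  obtain ⟨k, hk, hka⟩ := hper a ha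
  have hpos : 0 < Function.minimalPeriod g a :=
    Function.IsPeriodicPt.minimalPeriod_pos hk hka
  refine ⟨(List.range (Function.minimalPeriod g a)).map (g^[·] a), ⟨⟨?_, ?_⟩, ?_⟩, ?_⟩
  · simpa using hpos.ne'
  · intro i
    simpa [Function.iterate_mod_minimalPeriod_eq] using hrel i
  · refine List.Nodup.map_on ?_ List.nodup_range
    intro x hx y hy hxy
    exact Function.iterate_injOn_Iio_minimalPeriod (List.mem_range.1 hx) (List.mem_range.1 hy) hxy
  · exact List.mem_map.2 ⟨0, List.mem_range.2 hpos, rfl⟩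

theorem card_cycles (hG : G.Gentle) (P : ℕ → Prop) :
    Nat.card (Quotient (G.cycleSetoid fun p => G.IsMinZeroCycle p ∧ P p.length)) =
      Nat.card {S : Finset G.A //
        (∃ a, TransGen G.rel a a ∧ predSet G.rel a = S) ∧ P S.card} := by
  have hS : ∀ p : List G.A, G.IsMinZeroCycle p ∧ P p.length →
      (∃ a, TransGen G.rel a a ∧ predSet G.rel a = p.toFinset) ∧ P p.toFinset.card := by
    rintro p ⟨⟨hp, hn⟩, hP⟩
    refine ⟨⟨p[0]'hp.length_pos, hp.transGen (List.getElem_mem _),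
      hp.predSet_eq hG (List.getElem_mem _)⟩, ?_⟩
    rwa [List.toFinset_card_of_nodup hn]
  refine Nat.card_congr (Equiv.ofBijective (Quotient.lift (fun p => ⟨p.1.toFinset, hS p.1 p.2⟩) ?_)
    ⟨?_, ?_⟩)
  · intro p q hpq
    have hpq' : p.1 ~r q.1 := hpq
    exact Subtype.ext (List.toFinset_eq_of_perm _ _ hpq'.perm)
  · rintro ⟨p⟩ ⟨q⟩ h
    have h' : p.1.toFinset = q.1.toFinset := congrArg Subtype.val h
    obtain ⟨p, ⟨hp, hpn⟩, hpP⟩ := p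
    obtain ⟨q, ⟨hq, hqn⟩, hqP⟩ := q
    refine Quotient.sound (?_ : p ~r q)
    refine hp.isRotated hG hq ?_ ?_
    · rw [← List.toFinset_card_of_nodup hpn, ← List.toFinset_card_of_nodup hqn, h']
    · rw [← List.mem_toFinset, ← h', List.mem_toFinset]
      exact List.getElem_mem _
  · rintro ⟨S, ⟨a, ha, rfl⟩, hP⟩
    obtain ⟨p, hp, hap⟩ := exists_isMinZeroCycle hG ha
    have e := hp.1.predSet_eq hG hap
    refine ⟨Quotient.mk _ ⟨p, hp, ?_⟩, Subtype.ext e.symm⟩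
    rwa [← List.toFinset_card_of_nodup hp.2, ← e]

open Classical in
theorem det_one_add_relMatrix (hG : G.Gentle) {M : Matrix G.A G.A ℤ}
    (hM : ∀ i j, M i j = (if i = j then 1 else 0) + (if G.rel i j then 1 else 0)) :
    M.det = if 0 < G.ec then 0 else 2 ^ G.oc := by
  rw [det_one_add_rel hG.2.1 hG.2.2 hM, ec, oc, card_cycles hG, card_cycles hG]
  split_ifs with h
  · obtain ⟨⟨S, hS, hev⟩⟩ := (Nat.card_pos_iff.1 h).1
    refine Finset.prod_eq_zero (Finset.mem_univ S) ?_
    rw [if_pos hS, if_pos hev]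
  · rw [Nat.card_eq_fintype_card, Fintype.card_subtype, ← Finset.prod_const, Finset.prod_filter]
    refine Finset.prod_congr rfl fun S _ => ?_
    by_cases hS : ∃ a, TransGen G.rel a a ∧ predSet G.rel a = S
    · have hev : ¬ Even S.card := fun hev => h (Nat.card_pos_iff.2 ⟨⟨⟨S, hS, hev⟩⟩, inferInstance⟩)
      rw [if_pos hS, if_neg hev, if_pos ⟨hS, Nat.not_even_iff_odd.1 hev⟩]
    · rw [if_neg hS, if_neg fun h => hS h.1]

end QuivRel

/-- The number of lists satisfying a predicate, sorted by their first entry. -/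
theorem card_list_eq {α : Type} [Fintype α] (P : List α → Prop) [Decidable (P [])]
    (h : Finite {l // P l}) :
    Nat.card {l // P l} = (if P [] then 1 else 0) + ∑ b, Nat.card {l // P (b :: l)} := by
  have hb : ∀ b, Finite {l // P (b :: l)} := fun b =>
    Finite.of_injective (fun l => (⟨b :: l.1, l.2⟩ : {l // P l})) fun x y hxy =>
      Subtype.ext (List.cons_injective (congrArg Subtype.val hxy))
  let e : {l // P l} ≃ {_u : Unit // P []} ⊕ Σ b, {l // P (b :: l)} :=
    { toFun := fun l => match l with
        | ⟨[], h⟩ => .inl ⟨(), h⟩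
        | ⟨b :: l, h⟩ => .inr ⟨b, l, h⟩
      invFun := fun x => match x with
        | .inl u => ⟨[], u.2⟩
        | .inr x => ⟨x.1 :: x.2.1, x.2.2⟩
      left_inv := by rintro ⟨_ | ⟨b, l⟩, h⟩ <;> rfl
      right_inv := by rintro (u | x) <;> rfl }
  rw [Nat.card_congr e, Nat.card_sum, Nat.card_sigma]
  congr 1
  split_ifs with h <;> simp [h]

namespace QuivRel

variable {G : QuivRel}

/-- The composable pairs of arrows that are not relations. -/
def Step (G : QuivRel) (a b : G.A) : Prop := G.tgt a = G.src b ∧ ¬ G.rel a b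

/-- `a :: l` is a nonzero path ending at `j`. -/
def PathTo (G : QuivRel) (a : G.A) (j : G.V) (l : List G.A) : Prop :=
  G.IsNonzeroPath (a :: l) ∧ ∀ c ∈ (a :: l).getLast?, G.tgt c = j

theorem isNonzeroPath_cons_cons {a b : G.A} {l : List G.A} :
    G.IsNonzeroPath (a :: b :: l) ↔ G.Step a b ∧ G.IsNonzeroPath (b :: l) :=
  List.isChain_cons_cons

theorem pathTo_nil {a : G.A} {j : G.V} : G.PathTo a j [] ↔ G.tgt a = j := by
  simp [PathTo, show G.IsNonzeroPath [a] from List.isChain_singleton a]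

theorem pathTo_cons {a b : G.A} {j : G.V} {l : List G.A} :
    G.PathTo a j (b :: l) ↔ G.Step a b ∧ G.PathTo b j l := by
  simp only [PathTo, isNonzeroPath_cons_cons, List.getLast?_cons_cons, and_assoc]

theorem isNonzeroPathFrom_nil {i j : G.V} : G.IsNonzeroPathFrom i j [] ↔ i = j := by
  simp [IsNonzeroPathFrom, show G.IsNonzeroPath [] from List.isChain_nil]

theorem isNonzeroPathFrom_cons {i j : G.V} {b : G.A} {l : List G.A} :
    G.IsNonzeroPathFrom i j (b :: l) ↔ G.src b = i ∧ G.PathTo b j l := by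
  simp [IsNonzeroPathFrom, PathTo]
  tauto

theorem FinDim.finite (hfd : G.FinDim) {P : List G.A → Prop}
    (hP : ∀ l, P l → G.IsNonzeroPath l) : Finite {l // P l} := by
  obtain ⟨N, hN⟩ := hfd
  exact (List.finite_length_le G.A N).subset fun l hl => hN l (hP l hl)

theorem FinDim.finite_pathTo (hfd : G.FinDim) (a : G.A) (j : G.V) :
    Finite {l // G.PathTo a j l} := by
  have := hfd.finite (P := fun l => G.IsNonzeroPath l) fun _ h => h
  exact Finite.of_injective (fun l => (⟨a :: l.1, l.2.1⟩ : {l // G.IsNonzeroPath l}))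
    fun x y hxy => Subtype.ext (List.cons_injective (congrArg Subtype.val hxy))

theorem FinDim.step_acyclic (hfd : G.FinDim) (a : G.A) : ¬ TransGen G.Step a a := by
  intro ha
  have hext : ∀ {a b : G.A}, TransGen G.Step a b → ∀ l, G.IsNonzeroPath (b :: l) →
      ∃ l', G.IsNonzeroPath (a :: l') ∧ l.length < l'.length := by
    intro a b hab l hl
    induction hab using TransGen.head_induction_on with
    | single h => exact ⟨b :: l, isNonzeroPath_cons_cons.2 ⟨h, hl⟩, by simp⟩
    | head h _ ih =>
      obtain ⟨l', hl', hlt⟩ := ih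
      exact ⟨_ :: l', isNonzeroPath_cons_cons.2 ⟨h, hl'⟩, by simp; omega⟩
  have hlong : ∀ n : ℕ, ∃ l, G.IsNonzeroPath (a :: l) ∧ n ≤ l.length := by
    intro n
    induction n with
    | zero => exact ⟨[], List.isChain_singleton a, Nat.zero_le _⟩
    | succ n ih =>
      obtain ⟨l, hl, hn⟩ := ih
      obtain ⟨l', hl', hlt⟩ := hext ha l hl
      exact ⟨l', hl', by omega⟩
  obtain ⟨N, hN⟩ := hfd
  obtain ⟨l, hl, hn⟩ := hlong N
  have := hN _ hl
  simp at this
  omega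

theorem card_and {α : Type} (p : Prop) [Decidable p] (Q : α → Prop) :
    (Nat.card {x // p ∧ Q x} : ℤ) = (if p then 1 else 0) * Nat.card {x // Q x} := by
  by_cases h : p <;> simp [h]

end QuivRel

open Classical QuivRel in
theorem cartan_det_eq_det_one_add (G : QuivRel) (hfd : G.FinDim) :
    G.cartan.det =
      (Matrix.of fun i j => (if i = j then 1 else 0) + (if G.rel i j then 1 else 0) :
        Matrix G.A G.A ℤ).det := by
  let S : Matrix G.V G.A ℤ := Matrix.of fun i a => if G.src a = i then 1 else 0
  let T : Matrix G.A G.V ℤ := Matrix.of fun a j => if G.tgt a = j then 1 else 0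
  let N : Matrix G.A G.A ℤ := Matrix.of fun a b => if G.Step a b then 1 else 0
  let U : Matrix G.A G.V ℤ := Matrix.of fun a j => (Nat.card {l // G.PathTo a j l} : ℤ)
  have hC : G.cartan = 1 + S * U := by
    ext i j
    have hfin := hfd.finite (P := G.IsNonzeroPathFrom i j) fun _ h => h.1
    simp only [cartan, Matrix.add_apply, Matrix.mul_apply, Matrix.one_apply, S, U,
      Matrix.of_apply, card_list_eq _ hfin, isNonzeroPathFrom_nil, isNonzeroPathFrom_cons,
      Nat.cast_add, Nat.cast_sum, card_and, Nat.cast_ite, Nat.cast_one, Nat.cast_zero]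
  have hU : U = T + N * U := by
    ext a j
    have hfin := hfd.finite_pathTo a j
    conv_lhs => simp only [U, Matrix.of_apply, card_list_eq _ hfin]
    simp only [Matrix.add_apply, Matrix.mul_apply, T, N, U,
      Matrix.of_apply, pathTo_nil, pathTo_cons,
      Nat.cast_add, Nat.cast_sum, card_and, Nat.cast_ite, Nat.cast_one, Nat.cast_zero]
  have hdet : (1 - N).det = 1 := by
    refine det_eq_one_of_acyclic (r := G.Step) ?_ hfd.step_acyclic ?_
    · intro i j hij
      by_contra! h
      simp [N, h.1, h.2] at hij
    · intro a
      simp [N, show ¬ G.Step a a from fun h => hfd.step_acyclic a (.single h)]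
  have hT : (1 - N) * U = T := by
    rw [Matrix.sub_mul, Matrix.one_mul, sub_eq_iff_eq_add]
    exact hU
  have hmul : G.cartan.det = (1 - N + T * S).det := by
    have hfac : 1 - N + T * S = (1 - N) * (1 + U * S) := by
      rw [Matrix.mul_add, Matrix.mul_one, ← Matrix.mul_assoc, hT]
    rw [hC, Matrix.det_one_add_mul_comm, hfac, Matrix.det_mul, hdet, one_mul]
  rw [hmul]
  congr 1
  ext a b
  have hTS : (T * S) a b = if G.tgt a = G.src b then 1 else 0 := by
    simp [T, S, Matrix.mul_apply, eq_comm]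
  rw [Matrix.add_apply, hTS]
  simp only [Matrix.sub_apply, Matrix.one_apply, N, Matrix.of_apply, Step]
  by_cases hr : G.rel a b
  · simp [hr, G.rel_comp a b hr]
  · simp [hr]

/-- **Corollary 2.** Let `(Q,I)` be a gentle quiver and `A = KQ/I` the
corresponding (finite-dimensional) gentle algebra.  Then `det C_A = 0` if
`ec(Q,I) > 0`, and `det C_A = 2^{oc(Q,I)}` otherwise. -/
theorem cartan_det (G : QuivRel) (hG : G.Gentle) (hfd : G.FinDim) :
    G.cartan.det = if 0 < G.ec then 0 else 2 ^ G.oc := by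
  rw [cartan_det_eq_det_one_add G hfd]
  exact QuivRel.det_one_add_relMatrix hG fun _ _ => rfl
end
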